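/- For every nonnegative integer n, the number of square-lattice walks of length 2n that start at (0,0), end at (0,0), and are confined to the three-quadrant cone C equals (4·16^n / 3^5) · ( 3^4 · (1/2)_n (1/2)_{n+1} / ( (2)_n (2)_{n+1} ) + 4·(24n² + 60n + 29) · (1/2)_n (7/6)_n / ( (2)_{n+1} (4/3)_{n+1} ) − 2·(12n² + 30n + 5) · (1/2)_n (5/6)_n / ( (2)_{n+1} (5/3)_{n+1} ) ). -/

import Mathlib

/-- Square-lattice steps. -/
def squareSteps : Set (ℤ × ℤ) := {(1,0), (-1,0), (0,1), (0,-1)}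

/-- Diagonal-lattice steps. -/
def diagSteps : Set (ℤ × ℤ) := {(1,1), (1,-1), (-1,1), (-1,-1)}

/-- The three-quadrant cone `C = {(i,j) : i ≥ 0 or j ≥ 0}`. -/
def coneC : Set (ℤ × ℤ) := {p | 0 ≤ p.1 ∨ 0 ≤ p.2}

/-- The quadrant `Q = {(i,j) : i ≥ 0 and j ≥ 0}`. -/
def quadQ : Set (ℤ × ℤ) := {p | 0 ≤ p.1 ∧ 0 ≤ p.2}

/-- Number of walks of length `n` with steps in `steps`, from `a` to `b`,
confined to `region`. -/
noncomputable def walkCount (steps region : Set (ℤ × ℤ)) (a b : ℤ × ℤ) (n : ℕ) : ℕ :=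
  Nat.card {w : Fin (n+1) → ℤ × ℤ //
    w 0 = a ∧ w (Fin.last n) = b ∧
    (∀ k : Fin n, w k.succ - w k.castSucc ∈ steps) ∧
    (∀ k, w k ∈ region)}

/-- Ascending factorial (Pochhammer symbol) `(a)ₙ = a(a+1)⋯(a+n-1)`. -/
noncomputable def poch (a : ℚ) (n : ℕ) : ℚ := (ascPochhammer ℚ n).eval a

open PowerSeries

/-- The Euler operator `X · d/dX`. -/
noncomputable def eulerOp : Derivation ℚ ℚ⟦X⟧ ℚ⟦X⟧ := (X : ℚ⟦X⟧) • PowerSeries.derivative ℚ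

theorem coeff_eulerOp (f : ℚ⟦X⟧) (n : ℕ) : coeff n (eulerOp f) = n * coeff n f := by
  cases n with
  | zero => simp [eulerOp]
  | succ n => simp [eulerOp, coeff_succ_X_mul, coeff_derivative, mul_comm]

theorem eulerOp_mul (f g : ℚ⟦X⟧) : eulerOp (f * g) = f * eulerOp g + g * eulerOp f := by
  simp [Derivation.leibniz]

theorem eulerOp_pow (f : ℚ⟦X⟧) (n : ℕ) : eulerOp (f ^ n) = n * f ^ (n - 1) * eulerOp f := by
  simp [Derivation.leibniz_pow, nsmul_eq_mul, mul_assoc]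

theorem eulerOp_aeval (p : Polynomial ℚ) {Z t : ℚ⟦X⟧} (hZ : eulerOp Z = Z * t) :
    eulerOp (Polynomial.aeval Z p) =
      t * Polynomial.aeval Z (Polynomial.X * Polynomial.derivative p) := by
  rw [Derivation.map_aeval]
  simp [hZ]; ring

/-- Numerator of the Euler derivative of `p(Z) / Z ^ k`. -/
noncomputable def eulerNum (k : ℕ) (p : Polynomial ℚ) : Polynomial ℚ :=
  Polynomial.X * Polynomial.derivative p - (k : Polynomial ℚ) * p

/-- If `Z ^ k * f = u * p(Z)`, then the Euler derivative of `f` has a similar shape. -/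
theorem eulerOp_of_pow_mul (p : Polynomial ℚ) {k : ℕ} {Z t u f : ℚ⟦X⟧} (hZ : eulerOp Z = Z * t)
    (hf : Z ^ k * f = u * Polynomial.aeval Z p) :
    Z ^ k * eulerOp f = eulerOp u * Polynomial.aeval Z p +
      u * t * Polynomial.aeval Z (eulerNum k p) := by
  have h := congrArg eulerOp hf
  rw [eulerOp_mul, eulerOp_mul, eulerOp_aeval p hZ, eulerOp_pow, hZ] at h
  rw [eulerNum, map_sub, map_mul (Polynomial.aeval Z) (k : Polynomial ℚ) p]
  rcases k with _ | k
  · simp at h ⊢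
    linear_combination h
  · simp only [map_natCast, Nat.add_sub_cancel] at h ⊢
    linear_combination h - (k + 1 : ℕ) * t * hf

theorem exists_pow_mul_eq {Z : ℚ⟦X⟧} (hZ : constantCoeff Z ≠ 0) (k : ℕ) (g : ℚ⟦X⟧) :
    ∃ f, Z ^ k * f = g :=
  ⟨(Z ^ k)⁻¹ * g, by
    rw [← mul_assoc, PowerSeries.mul_inv_cancel _ (by simpa using pow_ne_zero k hZ), one_mul]⟩

/-- Logarithmic Euler derivative `t` of the parametrization `Z` and its own derivative. -/
theorem exists_eulerOp_eq {Z : ℚ⟦X⟧} (hZ0 : constantCoeff Z = 1)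
    (hs : 256 * X * Z ^ 6 = (Z ^ 2 - 1) * (Z ^ 2 + 3) ^ 3) :
    ∃ t, eulerOp Z = Z * t ∧ 2 * (Z ^ 2 - 3) ^ 2 * t = (Z ^ 2 - 1) * (Z ^ 2 + 3) ∧
      (Z ^ 2 - 3) ^ 3 * eulerOp t = -8 * Z ^ 4 * t := by
  have hne : ∀ {f : ℚ⟦X⟧}, constantCoeff f ≠ 0 → f ≠ 0 := fun h h' => h (by simp [h'])
  have h3 : Z ^ 2 - 3 ≠ 0 := hne (by simp [hZ0, map_ofNat]; norm_num)
  have h4 : Z ^ 2 + 3 ≠ 0 := hne (by simp [hZ0, map_ofNat]; norm_num)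
  have hz : Z ≠ 0 := hne (by simp [hZ0])
  obtain ⟨t, ht⟩ := exists_pow_mul_eq (Z := Z) (by simp [hZ0]) 1 (eulerOp Z)
  rw [pow_one] at ht
  have hX : eulerOp (X : ℚ⟦X⟧) = X := by simp [eulerOp]
  have h2 : eulerOp (2 : ℚ⟦X⟧) = 0 := eulerOp.map_natCast 2
  have h3' : eulerOp (3 : ℚ⟦X⟧) = 0 := eulerOp.map_natCast 3
  have h256 : eulerOp (256 : ℚ⟦X⟧) = 0 := eulerOp.map_natCast 256
  have e := congrArg eulerOp hs
  simp only [eulerOp_mul, eulerOp_pow, map_add, map_sub, h3', h256, hX, ← ht,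
    Derivation.map_one_eq_zero] at e
  norm_num at e
  have key : 2 * (Z ^ 2 - 3) ^ 2 * t = (Z ^ 2 - 1) * (Z ^ 2 + 3) := by
    apply mul_left_cancel₀ (pow_ne_zero 2 h4)
    linear_combination -e + (1 + 6 * t) * hs
  refine ⟨t, ht.symm, key, ?_⟩
  have e' := congrArg eulerOp key
  simp only [eulerOp_mul, eulerOp_pow, map_add, map_sub, h3', h2, ← ht,
      Derivation.map_one_eq_zero] at e'
  norm_num at e'
  apply mul_left_cancel₀ (hne (by simp [map_ofNat]) : (2 : ℚ⟦X⟧) ≠ 0)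
  linear_combination (Z^2-3) * e' - 4 * Z^2 * t * key

theorem hyper_four_thirds_field {K : Type*} [Field K] [CharZero K] {Z s t t' w w1 w2 : K}
    (hZ : Z ≠ 0) (h3 : Z ^ 2 - 3 ≠ 0)
    (hs : 256 * s * Z ^ 6 = (Z ^ 2 - 1) * (Z ^ 2 + 3) ^ 3)
    (ht : 2 * (Z ^ 2 - 3) ^ 2 * t = (Z ^ 2 - 1) * (Z ^ 2 + 3))
    (ht' : (Z ^ 2 - 3) ^ 3 * t' = -8 * Z ^ 4 * t)
    (hw : Z ^ 9 * w = 81 / 5120 - 81 / 1024 * Z ^ 3 + 81 / 1024 * Z ^ 4 - 27 / 640 * Z ^ 6 +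
        27 / 512 * Z ^ 7 - 261 / 5120 * Z ^ 8 + 23 / 640 * Z ^ 9 - 9 / 640 * Z ^ 10 +
        3 / 1024 * Z ^ 11 - 1 / 5120 * Z ^ 12)
    (hw1 : Z ^ 9 * w1 = t * (- 729 / 5120 + 243 / 512 * Z ^ 3 - 405 / 1024 * Z ^ 4 +
        81 / 640 * Z ^ 6 - 27 / 256 * Z ^ 7 + 261 / 5120 * Z ^ 8 - 9 / 640 * Z ^ 10 +
        3 / 512 * Z ^ 11 - 3 / 5120 * Z ^ 12))
    (hw2 : Z ^ 9 * w2 = t' * (- 729 / 5120 + 243 / 512 * Z ^ 3 - 405 / 1024 * Z ^ 4 +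
        81 / 640 * Z ^ 6 - 27 / 256 * Z ^ 7 + 261 / 5120 * Z ^ 8 - 9 / 640 * Z ^ 10 +
        3 / 512 * Z ^ 11 - 3 / 5120 * Z ^ 12) +
      t * t * (6561 / 5120 - 729 / 256 * Z ^ 3 + 2025 / 1024 * Z ^ 4 - 243 / 640 * Z ^ 6 +
          27 / 128 * Z ^ 7 - 261 / 5120 * Z ^ 8 - 9 / 640 * Z ^ 10 + 3 / 256 * Z ^ 11 -
          9 / 5120 * Z ^ 12)) :
    w2 - 2 / 3 * w1 - 16 * s * (w2 - (3 / 2 + (5 / 6)) * w1 + 3 / 2 * (5 / 6) * w) = s ^ 2 := by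
  have hs' : s = (Z ^ 2 - 1) * (Z ^ 2 + 3) ^ 3 / (256 * Z ^ 6) := by
    field_simp; linear_combination hs
  have ht1 : t = (Z ^ 2 - 1) * (Z ^ 2 + 3) / (2 * (Z ^ 2 - 3) ^ 2) := by
    field_simp; linear_combination ht
  have ht2 : t' = -8 * Z ^ 4 * t / (Z ^ 2 - 3) ^ 3 := by
    field_simp; linear_combination ht'
  rw [mul_comm, ← eq_div_iff (pow_ne_zero _ hZ)] at hw hw1 hw2
  rw [hw, hw1, hw2, ht2, ht1, hs']
  field_simp
  ring

theorem hyper_five_thirds_field {K : Type*} [Field K] [CharZero K] {Z s t t' w w1 w2 : K}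
    (hZ : Z ≠ 0) (h3 : Z ^ 2 - 3 ≠ 0)
    (hs : 256 * s * Z ^ 6 = (Z ^ 2 - 1) * (Z ^ 2 + 3) ^ 3)
    (ht : 2 * (Z ^ 2 - 3) ^ 2 * t = (Z ^ 2 - 1) * (Z ^ 2 + 3))
    (ht' : (Z ^ 2 - 3) ^ 3 * t' = -8 * Z ^ 4 * t)
    (hw : Z ^ 9 * w = 81 / 3584 - 729 / 8960 * Z ^ 2 + 81 / 1024 * Z ^ 3 - 81 / 3584 * Z ^ 4 +
        81 / 4480 * Z ^ 6 - 27 / 512 * Z ^ 7 + 1179 / 17920 * Z ^ 8 - 37 / 896 * Z ^ 9 +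
        27 / 1792 * Z ^ 10 - 3 / 1024 * Z ^ 11 + 1 / 3584 * Z ^ 12)
    (hw1 : Z ^ 9 * w1 = t * (- 729 / 3584 + 729 / 1280 * Z ^ 2 - 243 / 512 * Z ^ 3 +
        405 / 3584 * Z ^ 4 - 243 / 4480 * Z ^ 6 + 27 / 256 * Z ^ 7 - 1179 / 17920 * Z ^ 8 +
        27 / 1792 * Z ^ 10 - 3 / 512 * Z ^ 11 + 3 / 3584 * Z ^ 12))
    (hw2 : Z ^ 9 * w2 = t' * (- 729 / 3584 + 729 / 1280 * Z ^ 2 - 243 / 512 * Z ^ 3 +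
        405 / 3584 * Z ^ 4 - 243 / 4480 * Z ^ 6 + 27 / 256 * Z ^ 7 - 1179 / 17920 * Z ^ 8 +
        27 / 1792 * Z ^ 10 - 3 / 512 * Z ^ 11 + 3 / 3584 * Z ^ 12) +
      t * t * (6561 / 3584 - 5103 / 1280 * Z ^ 2 + 729 / 256 * Z ^ 3 - 2025 / 3584 * Z ^ 4 +
          729 / 4480 * Z ^ 6 - 27 / 128 * Z ^ 7 + 1179 / 17920 * Z ^ 8 + 27 / 1792 * Z ^ 10 -
          3 / 256 * Z ^ 11 + 9 / 3584 * Z ^ 12)) :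
    w2 - 1 / 3 * w1 - 16 * s * (w2 - (3 / 2 + (7 / 6)) * w1 + 3 / 2 * (7 / 6) * w) = s ^ 2 := by
  have hs' : s = (Z ^ 2 - 1) * (Z ^ 2 + 3) ^ 3 / (256 * Z ^ 6) := by
    field_simp; linear_combination hs
  have ht1 : t = (Z ^ 2 - 1) * (Z ^ 2 + 3) / (2 * (Z ^ 2 - 3) ^ 2) := by
    field_simp; linear_combination ht
  have ht2 : t' = -8 * Z ^ 4 * t / (Z ^ 2 - 3) ^ 3 := by
    field_simp; linear_combination ht'
  rw [mul_comm, ← eq_div_iff (pow_ne_zero _ hZ)] at hw hw1 hw2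
  rw [hw, hw1, hw2, ht2, ht1, hs']
  field_simp
  ring

theorem combination_field {K : Type*} [Field K] [CharZero K]
    {Z s t t' w w1 w2 v v1 v2 P : K} (hZ : Z ≠ 0) (h3 : Z ^ 2 - 3 ≠ 0) (h4 : Z ^ 2 + 3 ≠ 0)
    (hs : 256 * s * Z ^ 6 = (Z ^ 2 - 1) * (Z ^ 2 + 3) ^ 3)
    (ht : 2 * (Z ^ 2 - 3) ^ 2 * t = (Z ^ 2 - 1) * (Z ^ 2 + 3))
    (ht' : (Z ^ 2 - 3) ^ 3 * t' = -8 * Z ^ 4 * t)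
    (hw : Z ^ 9 * w = 81 / 5120 - 81 / 1024 * Z ^ 3 + 81 / 1024 * Z ^ 4 - 27 / 640 * Z ^ 6 +
        27 / 512 * Z ^ 7 - 261 / 5120 * Z ^ 8 + 23 / 640 * Z ^ 9 - 9 / 640 * Z ^ 10 +
        3 / 1024 * Z ^ 11 - 1 / 5120 * Z ^ 12)
    (hw1 : Z ^ 9 * w1 = t * (- 729 / 5120 + 243 / 512 * Z ^ 3 - 405 / 1024 * Z ^ 4 +
        81 / 640 * Z ^ 6 - 27 / 256 * Z ^ 7 + 261 / 5120 * Z ^ 8 - 9 / 640 * Z ^ 10 +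
        3 / 512 * Z ^ 11 - 3 / 5120 * Z ^ 12))
    (hw2 : Z ^ 9 * w2 = t' * (- 729 / 5120 + 243 / 512 * Z ^ 3 - 405 / 1024 * Z ^ 4 +
        81 / 640 * Z ^ 6 - 27 / 256 * Z ^ 7 + 261 / 5120 * Z ^ 8 - 9 / 640 * Z ^ 10 +
        3 / 512 * Z ^ 11 - 3 / 5120 * Z ^ 12) +
      t * t * (6561 / 5120 - 729 / 256 * Z ^ 3 + 2025 / 1024 * Z ^ 4 - 243 / 640 * Z ^ 6 +
          27 / 128 * Z ^ 7 - 261 / 5120 * Z ^ 8 - 9 / 640 * Z ^ 10 + 3 / 256 * Z ^ 11 -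
          9 / 5120 * Z ^ 12))
    (hv : Z ^ 9 * v = 81 / 3584 - 729 / 8960 * Z ^ 2 + 81 / 1024 * Z ^ 3 - 81 / 3584 * Z ^ 4 +
        81 / 4480 * Z ^ 6 - 27 / 512 * Z ^ 7 + 1179 / 17920 * Z ^ 8 - 37 / 896 * Z ^ 9 +
        27 / 1792 * Z ^ 10 - 3 / 1024 * Z ^ 11 + 1 / 3584 * Z ^ 12)
    (hv1 : Z ^ 9 * v1 = t * (- 729 / 3584 + 729 / 1280 * Z ^ 2 - 243 / 512 * Z ^ 3 +
        405 / 3584 * Z ^ 4 - 243 / 4480 * Z ^ 6 + 27 / 256 * Z ^ 7 - 1179 / 17920 * Z ^ 8 +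
        27 / 1792 * Z ^ 10 - 3 / 512 * Z ^ 11 + 3 / 3584 * Z ^ 12))
    (hv2 : Z ^ 9 * v2 = t' * (- 729 / 3584 + 729 / 1280 * Z ^ 2 - 243 / 512 * Z ^ 3 +
        405 / 3584 * Z ^ 4 - 243 / 4480 * Z ^ 6 + 27 / 256 * Z ^ 7 - 1179 / 17920 * Z ^ 8 +
        27 / 1792 * Z ^ 10 - 3 / 512 * Z ^ 11 + 3 / 3584 * Z ^ 12) +
      t * t * (6561 / 3584 - 5103 / 1280 * Z ^ 2 + 729 / 256 * Z ^ 3 - 2025 / 3584 * Z ^ 4 +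
          729 / 4480 * Z ^ 6 - 27 / 128 * Z ^ 7 + 1179 / 17920 * Z ^ 8 + 27 / 1792 * Z ^ 10 -
          3 / 256 * Z ^ 11 + 9 / 3584 * Z ^ 12))
    (hP : Z ^ 3 * (Z ^ 2 + 3) ^ 3 * P = 8 * (Z ^ 2 + 1) ^ 2 * (Z ^ 4 + 4 * Z ^ 2 - 1)) :
    s * (P - 2) = 4 / 81 * (4 * (24 * w2 - 36 * w1 + 5 * w) - 2 * (12 * v2 - 18 * v1 - 7 * v)) := by
  have hs' : s = (Z ^ 2 - 1) * (Z ^ 2 + 3) ^ 3 / (256 * Z ^ 6) := by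
    field_simp; linear_combination hs
  have ht1 : t = (Z ^ 2 - 1) * (Z ^ 2 + 3) / (2 * (Z ^ 2 - 3) ^ 2) := by
    field_simp; linear_combination ht
  have ht2 : t' = -8 * Z ^ 4 * t / (Z ^ 2 - 3) ^ 3 := by
    field_simp; linear_combination ht'
  have hP' : P = 8 * (Z ^ 2 + 1) ^ 2 * (Z ^ 4 + 4 * Z ^ 2 - 1) / (Z ^ 3 * (Z ^ 2 + 3) ^ 3) := by
    field_simp; linear_combination hP
  rw [mul_comm, ← eq_div_iff (pow_ne_zero _ hZ)] at hw hw1 hw2 hv hv1 hv2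
  rw [hw, hw1, hw2, hv, hv1, hv2, ht2, ht1, hs', hP']
  field_simp
  ring

/-- Numerator of the series `X² ∑ 16ⁿ (1/2)ₙ (7/6)ₙ / ((2)ₙ₊₁ (4/3)ₙ₊₁) Xⁿ` in terms of `Z`. -/
noncomputable def numFourThirds : Polynomial ℚ :=
  Polynomial.C (81 / 5120) - Polynomial.C (81 / 1024) * Polynomial.X ^ 3
    + Polynomial.C (81 / 1024) * Polynomial.X ^ 4 - Polynomial.C (27 / 640) * Polynomial.X ^ 6
    + Polynomial.C (27 / 512) * Polynomial.X ^ 7 - Polynomial.C (261 / 5120) * Polynomial.X ^ 8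
    + Polynomial.C (23 / 640) * Polynomial.X ^ 9 - Polynomial.C (9 / 640) * Polynomial.X ^ 10
    + Polynomial.C (3 / 1024) * Polynomial.X ^ 11 - Polynomial.C (1 / 5120) * Polynomial.X ^ 12


/-- Numerator of the series `X² ∑ 16ⁿ (1/2)ₙ (5/6)ₙ / ((2)ₙ₊₁ (5/3)ₙ₊₁) Xⁿ` in terms of `Z`. -/
noncomputable def numFiveThirds : Polynomial ℚ :=
  Polynomial.C (81 / 3584) - Polynomial.C (729 / 8960) * Polynomial.X ^ 2
    + Polynomial.C (81 / 1024) * Polynomial.X ^ 3 - Polynomial.C (81 / 3584) * Polynomial.X ^ 4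
    + Polynomial.C (81 / 4480) * Polynomial.X ^ 6 - Polynomial.C (27 / 512) * Polynomial.X ^ 7
    + Polynomial.C (1179 / 17920) * Polynomial.X ^ 8
    - Polynomial.C (37 / 896) * Polynomial.X ^ 9 + Polynomial.C (27 / 1792) * Polynomial.X ^ 10
    - Polynomial.C (3 / 1024) * Polynomial.X ^ 11 + Polynomial.C (1 / 3584) * Polynomial.X ^ 12

theorem aeval_numFourThirds {K : Type*} [Field K] [CharZero K] [Algebra ℚ K] (Z : K) :
    Polynomial.aeval Z numFourThirds =
      81 / 5120 - 81 / 1024 * Z ^ 3 + 81 / 1024 * Z ^ 4 - 27 / 640 * Z ^ 6 + 27 / 512 * Z ^ 7 -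
          261 / 5120 * Z ^ 8 + 23 / 640 * Z ^ 9 - 9 / 640 * Z ^ 10 + 3 / 1024 * Z ^ 11 -
          1 / 5120 * Z ^ 12 := by
  simp [numFourThirds]

theorem aeval_eulerNum_numFourThirds {K : Type*} [Field K] [CharZero K] [Algebra ℚ K] (Z : K) :
    Polynomial.aeval Z (eulerNum 9 numFourThirds) =
      - 729 / 5120 + 243 / 512 * Z ^ 3 - 405 / 1024 * Z ^ 4 + 81 / 640 * Z ^ 6 -
          27 / 256 * Z ^ 7 + 261 / 5120 * Z ^ 8 - 9 / 640 * Z ^ 10 + 3 / 512 * Z ^ 11 -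
          3 / 5120 * Z ^ 12 := by
  simp [eulerNum, numFourThirds, map_ofNat]
  ring

theorem aeval_eulerNum_eulerNum_numFourThirds
    {K : Type*} [Field K] [CharZero K] [Algebra ℚ K] (Z : K) :
    Polynomial.aeval Z (eulerNum 9 (eulerNum 9 numFourThirds)) =
      6561 / 5120 - 729 / 256 * Z ^ 3 + 2025 / 1024 * Z ^ 4 - 243 / 640 * Z ^ 6 +
          27 / 128 * Z ^ 7 - 261 / 5120 * Z ^ 8 - 9 / 640 * Z ^ 10 + 3 / 256 * Z ^ 11 -
          9 / 5120 * Z ^ 12 := by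
  simp [eulerNum, numFourThirds, map_ofNat]
  ring

theorem aeval_numFiveThirds {K : Type*} [Field K] [CharZero K] [Algebra ℚ K] (Z : K) :
    Polynomial.aeval Z numFiveThirds =
      81 / 3584 - 729 / 8960 * Z ^ 2 + 81 / 1024 * Z ^ 3 - 81 / 3584 * Z ^ 4 +
          81 / 4480 * Z ^ 6 - 27 / 512 * Z ^ 7 + 1179 / 17920 * Z ^ 8 - 37 / 896 * Z ^ 9 +
          27 / 1792 * Z ^ 10 - 3 / 1024 * Z ^ 11 + 1 / 3584 * Z ^ 12 := by
  simp [numFiveThirds]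

theorem aeval_eulerNum_numFiveThirds {K : Type*} [Field K] [CharZero K] [Algebra ℚ K] (Z : K) :
    Polynomial.aeval Z (eulerNum 9 numFiveThirds) =
      - 729 / 3584 + 729 / 1280 * Z ^ 2 - 243 / 512 * Z ^ 3 + 405 / 3584 * Z ^ 4 -
          243 / 4480 * Z ^ 6 + 27 / 256 * Z ^ 7 - 1179 / 17920 * Z ^ 8 + 27 / 1792 * Z ^ 10 -
          3 / 512 * Z ^ 11 + 3 / 3584 * Z ^ 12 := by
  simp [eulerNum, numFiveThirds, map_ofNat]
  ring

theorem aeval_eulerNum_eulerNum_numFiveThirds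
    {K : Type*} [Field K] [CharZero K] [Algebra ℚ K] (Z : K) :
    Polynomial.aeval Z (eulerNum 9 (eulerNum 9 numFiveThirds)) =
      6561 / 3584 - 5103 / 1280 * Z ^ 2 + 729 / 256 * Z ^ 3 - 2025 / 3584 * Z ^ 4 +
          729 / 4480 * Z ^ 6 - 27 / 128 * Z ^ 7 + 1179 / 17920 * Z ^ 8 + 27 / 1792 * Z ^ 10 -
          3 / 256 * Z ^ 11 + 9 / 3584 * Z ^ 12 := by
  simp [eulerNum, numFiveThirds, map_ofNat]
  ring

theorem eulerOp_of_pow_nine_mul {Z t w : ℚ⟦X⟧} (p : Polynomial ℚ) (ht : eulerOp Z = Z * t)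
    (hw : Z ^ 9 * w = Polynomial.aeval Z p) :
    Z ^ 9 * eulerOp w = t * Polynomial.aeval Z (eulerNum 9 p) ∧
      Z ^ 9 * eulerOp (eulerOp w) = eulerOp t * Polynomial.aeval Z (eulerNum 9 p) +
        t * t * Polynomial.aeval Z (eulerNum 9 (eulerNum 9 p)) := by
  have h1 : Z ^ 9 * eulerOp w = t * Polynomial.aeval Z (eulerNum 9 p) := by
    simpa using eulerOp_of_pow_mul (u := 1) p ht (by rw [hw, one_mul])
  refine ⟨h1, ?_⟩
  exact eulerOp_of_pow_mul (eulerNum 9 p) ht h1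

theorem euler_equations {Z P : ℚ⟦X⟧} (hZ0 : constantCoeff Z = 1)
    (hs : 256 * X * Z ^ 6 = (Z ^ 2 - 1) * (Z ^ 2 + 3) ^ 3)
    (hP : Z ^ 3 * (Z ^ 2 + 3) ^ 3 * P = 8 * (Z ^ 2 + 1) ^ 2 * (Z ^ 4 + 4 * Z ^ 2 - 1)) :
    ∃ w v : ℚ⟦X⟧, constantCoeff w = 0 ∧ constantCoeff v = 0 ∧
      eulerOp (eulerOp w) - C (2 / 3) * eulerOp w - X * (C 16 * (eulerOp (eulerOp w)
        - C (3 / 2 + 5 / 6) * eulerOp w + C (3 / 2 * (5 / 6)) * w)) = X ^ 2 ∧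
      eulerOp (eulerOp v) - C (1 / 3) * eulerOp v - X * (C 16 * (eulerOp (eulerOp v)
        - C (3 / 2 + 7 / 6) * eulerOp v + C (3 / 2 * (7 / 6)) * v)) = X ^ 2 ∧
      X * (P - C 2) = C (4 / 81) * (C 4 * (C 24 * eulerOp (eulerOp w) - C 36 * eulerOp w + C 5 * w)
        - C 2 * (C 12 * eulerOp (eulerOp v) - C 18 * eulerOp v - C 7 * v)) := by
  have hne : ∀ {f : ℚ⟦X⟧}, constantCoeff f ≠ 0 → f ≠ 0 := fun h h' => h (by simp [h'])
  have h3 : Z ^ 2 - 3 ≠ 0 := hne (by simp [hZ0, map_ofNat]; norm_num)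
  have h4 : Z ^ 2 + 3 ≠ 0 := hne (by simp [hZ0, map_ofNat]; norm_num)
  have hz : Z ≠ 0 := hne (by simp [hZ0])
  obtain ⟨t, ht, ht1, ht2⟩ := exists_eulerOp_eq hZ0 hs
  obtain ⟨w, hw⟩ := exists_pow_mul_eq (Z := Z) (by simp [hZ0]) 9 (Polynomial.aeval Z numFourThirds)
  obtain ⟨v, hv⟩ := exists_pow_mul_eq (Z := Z) (by simp [hZ0]) 9 (Polynomial.aeval Z numFiveThirds)
  have cc (p : Polynomial ℚ) : constantCoeff (Polynomial.aeval Z p) = Polynomial.aeval (1 : ℚ) p := by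
    rw [← hZ0]; exact (Polynomial.aeval_algHom_apply (constantCoeff (R := ℚ)).toRatAlgHom Z p).symm
  have hw0 : constantCoeff w = 0 := by
    have := congrArg constantCoeff hw
    rw [cc, aeval_numFourThirds] at this
    simp only [map_mul, map_pow, hZ0] at this
    norm_num at this
    exact this
  have hv0 : constantCoeff v = 0 := by
    have := congrArg constantCoeff hv
    rw [cc, aeval_numFiveThirds] at this
    simp only [map_mul, map_pow, hZ0] at this
    norm_num at this
    exact this
  obtain ⟨hw1, hw2⟩ := eulerOp_of_pow_nine_mul _ ht hw
  obtain ⟨hv1, hv2⟩ := eulerOp_of_pow_nine_mul _ ht hv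
  have : CharZero (FractionRing ℚ⟦X⟧) := algebraRat.charZero _
  let φ := algebraMap ℚ⟦X⟧ (FractionRing ℚ⟦X⟧)
  have hinj : Function.Injective φ := IsFractionRing.injective ℚ⟦X⟧ _
  have hC : ∀ q : ℚ, φ (C q) = (q : FractionRing ℚ⟦X⟧) :=
    fun q => eq_ratCast (φ.comp (C (R := ℚ))) q
  have hae (p : Polynomial ℚ) : φ (Polynomial.aeval Z p) = Polynomial.aeval (φ Z) p :=
    (Polynomial.aeval_algebraMap_apply _ Z p).symm
  have n0 : ∀ {f : ℚ⟦X⟧}, f ≠ 0 → φ f ≠ 0 := fun h h' => h (hinj (by rw [h', map_zero]))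
  replace hs := congrArg φ hs
  replace ht1 := congrArg φ ht1
  replace ht2 := congrArg φ ht2
  replace hw := congrArg φ hw
  replace hw1 := congrArg φ hw1
  replace hw2 := congrArg φ hw2
  replace hv := congrArg φ hv
  replace hv1 := congrArg φ hv1
  replace hv2 := congrArg φ hv2
  replace hP := congrArg φ hP
  replace h3 := n0 h3
  replace h4 := n0 h4
  replace hz := n0 hz
  simp only [map_mul, map_pow, map_add, map_sub, map_neg, map_ofNat, map_one, hae,
      aeval_numFourThirds,
    aeval_eulerNum_numFourThirds, aeval_eulerNum_eulerNum_numFourThirds, aeval_numFiveThirds,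
    aeval_eulerNum_numFiveThirds, aeval_eulerNum_eulerNum_numFiveThirds]
    at hs ht1 ht2 hw hw1 hw2 hv hv1 hv2 hP h3 h4 hz
  refine ⟨w, v, hw0, hv0, hinj ?_, hinj ?_, hinj ?_⟩
  · simp [hC]
    linear_combination hyper_four_thirds_field hz h3 hs ht1 ht2 hw hw1 hw2
  · simp [hC]
    linear_combination hyper_five_thirds_field hz h3 hs ht1 ht2 hv hv1 hv2
  · simp [hC]
    linear_combination combination_field hz h3 h4 hs ht1 ht2 hw hw1 hw2 hv hv1 hv2 hP

theorem constantCoeff_eulerOp (f : ℚ⟦X⟧) : constantCoeff (eulerOp f) = 0 := by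
  simpa using coeff_eulerOp f 0

theorem poch_zero (a : ℚ) : poch a 0 = 1 := by simp [poch]

theorem poch_succ (a : ℚ) (n : ℕ) : poch a (n + 1) = poch a n * (a + n) :=
  ascPochhammer_succ_eval n a

theorem poch_pos {a : ℚ} (ha : 0 < a) (n : ℕ) : 0 < poch a n := ascPochhammer_pos n a ha

/-- Solution of the first order recurrence encoded by a second order differential equation. -/
theorem coeff_of_euler_eq {w : ℚ⟦X⟧} {a d e : ℚ} (ha1 : a < 1) (hd : d = 3 / 2 +
    e) (hw0 : constantCoeff w = 0)
    (h : eulerOp (eulerOp w) - C a * eulerOp w - X * (C 16 * (eulerOp (eulerOp w)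
        - C d * eulerOp w + C (3 / 2 * e) * w)) = X ^ 2) (n : ℕ) :
    coeff (n + 2) w =
      16 ^ n * (poch (1 / 2) n * poch (2 - e) n) / (poch 2 (n + 1) * poch (2 - a) (n + 1)) := by
  have h1 : coeff 1 w = 0 := by
    have := congrArg (coeff 1) h
    simp [coeff_eulerOp, coeff_succ_X_mul, hw0, coeff_X_pow,
      constantCoeff_eulerOp] at this
    rcases mul_eq_zero.1 (show (1 - a) * coeff 1 w = 0 by linear_combination this) with h | h
    · linarith
    · exact h
  have step (m : ℕ) := congrArg (coeff (m + 2)) h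
  simp only [map_sub, coeff_eulerOp, coeff_C_mul, coeff_succ_X_mul, map_add, coeff_X_pow] at step
  subst hd
  induction n with
  | zero =>
    have := step 0
    simp [h1] at this
    have h2 : (2 : ℚ) - a ≠ 0 := by linarith
    simp [poch_zero, poch_succ]
    field_simp
    linear_combination this
  | succ n ih =>
    have := step (n + 1)
    rw [if_neg (by omega)] at this
    rw [ih] at this
    have p1 := (poch_pos (show (0 : ℚ) < 2 by norm_num) (n + 1)).ne'
    have p2 := (poch_pos (show (0 : ℚ) < 2 - a by linarith) (n + 1)).ne'
    have q1 : (2 : ℚ) + (n + 1 : ℕ) ≠ 0 := by positivity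
    have q2 : (2 - a : ℚ) + (n + 1 : ℕ) ≠ 0 := by
      have : (0 : ℚ) ≤ (n + 1 : ℕ) := by positivity
      linarith
    rw [poch_succ (1 / 2), poch_succ (2 - e), poch_succ 2 (n + 1), poch_succ (2 - a) (n + 1)]
    field_simp at this ⊢
    push_cast at this ⊢
    linear_combination this
  
theorem coeff_hyper_combination {Z P : ℚ⟦X⟧} (hZ0 : constantCoeff Z = 1)
    (hs : 256 * X * Z ^ 6 = (Z ^ 2 - 1) * (Z ^ 2 + 3) ^ 3)
    (hP : Z ^ 3 * (Z ^ 2 + 3) ^ 3 * P = 8 * (Z ^ 2 + 1) ^ 2 * (Z ^ 4 + 4 * Z ^ 2 - 1)) (n : ℕ) :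
    coeff (n + 1) P = 4 * 16 ^ n / 81 * (4 * (24 * (n : ℚ)^2 + 60 * n + 29) *
              (poch (1/2) n * poch (7/6) n) / (poch 2 (n+1) * poch (4/3) (n+1))
          - 2 * (12 * (n : ℚ)^2 + 30 * n + 5) *
              (poch (1/2) n * poch (5/6) n) / (poch 2 (n+1) * poch (5/3) (n+1))) := by
  obtain ⟨w, v, hw0, hv0, hw, hv, h⟩ := euler_equations hZ0 hs hP
  have h' := congrArg (coeff (n + 2)) h
  simp only [map_sub, coeff_eulerOp, coeff_C_mul, coeff_succ_X_mul, map_add,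
    coeff_of_euler_eq (by norm_num) rfl hw0 hw, coeff_of_euler_eq (by norm_num) rfl hv0 hv,
        coeff_C] at h'
  norm_num at h'
  rw [h']
  ring

/-- The cofactor of the small root factor in the kernel, in the uniformising parameters. -/
def kernelCofactor {A : Type*} [CommRing A] (b m n : A) : A :=
  (1 + b * (2 + 4 * b - 6 * b ^ 2) * m + b ^ 2 * (1 + 4 * b - 4 * b ^ 2 - 16 * b ^ 3 + 15 * b
    ^ 4) * m ^ 2 - b ^ 5 * (2 + 8 * b - 4 * b ^ 2 - 24 * b ^ 3 + 18 * b ^ 4) * m ^ 3 + b ^ 8 *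
    (1 + 4 * b - 2 * b ^ 2 - 12 * b ^ 3 + 9 * b ^ 4) * m ^ 4) + ((1 + 2 * b - b ^ 2 + 2 * b ^
    3) - (1 + 3 * b - 4 * b ^ 2 - 8 * b ^ 3 + 7 * b ^ 4 - 11 * b ^ 5 + 12 * b ^ 6) * m + b ^ 3
    * (3 + 8 * b - 17 * b ^ 2 - 24 * b ^ 3 + 41 * b ^ 4 - 32 * b ^ 5 + 21 * b ^ 6) * m ^ 2 - b
    ^ 5 * (1 + 9 * b + 15 * b ^ 2 - 33 * b ^ 3 - 41 * b ^ 4 + 79 * b ^ 5 - 39 * b ^ 6 + 9 * b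
    ^ 7) * m ^ 3 + b ^ 8 * (1 + 8 * b + 13 * b ^ 2 - 24 * b ^ 3 - 37 * b ^ 4 + 48 * b ^ 5 - 9
    * b ^ 6) * m ^ 4) * n + (b ^ 3 * (2 + 5 * b - 2 * b ^ 2 + b ^ 3) - b ^ 3 * (2 + 8 * b - 4
    * b ^ 2 - 22 * b ^ 3 + 20 * b ^ 4 - 10 * b ^ 5 + 6 * b ^ 6) * m + b ^ 3 * (1 + 5 * b - 22
    * b ^ 3 + 6 * b ^ 4 + 26 * b ^ 5 - 64 * b ^ 6 + 54 * b ^ 7 - 15 * b ^ 8 + 9 * b ^ 9) * m ^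
    2 - b ^ 6 * (2 + 12 * b + 6 * b ^ 2 - 54 * b ^ 3 - 12 * b ^ 4 + 96 * b ^ 5 - 74 * b ^ 6 +
    42 * b ^ 7 - 18 * b ^ 8) * m ^ 3 + b ^ 9 * (2 + 13 * b + 14 * b ^ 2 - 41 * b ^ 3 - 34 * b
    ^ 4 + 67 * b ^ 5 - 30 * b ^ 6 + 9 * b ^ 7) * m ^ 4) * n ^ 2 + (b ^ 6 * (1 + 4 * b - b ^ 2)
    - b ^ 6 * (1 + 7 * b + 4 * b ^ 2 - 20 * b ^ 3 + 11 * b ^ 4 - 3 * b ^ 5) * m + b ^ 7 * (3 +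
    8 * b - 17 * b ^ 2 - 24 * b ^ 3 + 41 * b ^ 4 - 32 * b ^ 5 + 21 * b ^ 6) * m ^ 2 - b ^ 7 *
    (1 + 5 * b - b ^ 2 - 25 * b ^ 3 + 3 * b ^ 4 + 27 * b ^ 5 - 31 * b ^ 6 + 57 * b ^ 7 - 36 *
    b ^ 8) * m ^ 3 + b ^ 10 * (1 + 6 * b + 5 * b ^ 2 - 18 * b ^ 3 - 5 * b ^ 4 + 26 * b ^ 5 -
    33 * b ^ 6 + 18 * b ^ 7) * m ^ 4) * n ^ 3 + (b ^ 10 - b ^ 10 * (2 + 4 * b - 6 * b ^ 2) * m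
    + b ^ 10 * (1 + 4 * b - 4 * b ^ 2 - 16 * b ^ 3 + 15 * b ^ 4) * m ^ 2 + b ^ 12 * (2 + 8 * b
    - 4 * b ^ 2 - 24 * b ^ 3 + 18 * b ^ 4) * m ^ 3 + b ^ 14 * (1 + 4 * b - 2 * b ^ 2 - 12 * b
    ^ 3 + 9 * b ^ 4) * m ^ 4) * n ^ 4

section KernelQuotient

variable {A : Type*} [CommRing A] {b m n s X y w : A}

theorem kernel_factor (hw : w = (1 + 3 * b) * (1 - b))
    (hs : s * (1 - b) * (1 + 3 * b) ^ 3 = b)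
    (hy : y * (1 + b * n) ^ 2 = n * (1 + b ^ 3 * n) ^ 2)
    (hX : 1 - w * m - b ^ 2 * w * m ^ 2
      + X * w * (1 + 3 * b) * m * (1 + w * b * m - b ^ 4 * w * m ^ 2) = 0) :
    (s * (1 + y) - X * y + X ^ 2 * y * (1 + y))
        * ((w * (1 + 3 * b) * m * (1 + w * b * m - b ^ 4 * w * m ^ 2)) ^ 2 * (1 + b * n) ^ 4)
      = ((n + b * w * m ^ 2) * (1 + b ^ 2 * n) - w * (1 - b) * m * n)
        * kernelCofactor b m n := by
  set Y := n * (1 + b ^ 3 * n) ^ 2 with hY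
  set d := (1 + b * n) ^ 2 with hd
  set q := 1 + w * b * m - b ^ 4 * w * m ^ 2 with hq
  set j := 1 - w * m - b ^ 2 * w * m ^ 2 with hj
  set r := w * (1 + 3 * b) * m * q with hr
  have hX' : X * r = -j := by rw [hr]; linear_combination hX
  have hs' : s * (w * (1 + 3 * b)) ^ 2 = b * w := by
    rw [hw]; linear_combination (1 + 3 * b) * (1 - b) * hs
  have h1 : (s * (1 + y) - X * y + X ^ 2 * y * (1 + y)) * (r ^ 2 * (1 + b * n) ^ 4)
      = b * w * (m * q) ^ 2 * (d + Y) * d + j * r * Y * d + j ^ 2 * Y * (d + Y) := by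
    have e1 : s * r ^ 2 = b * w * (m * q) ^ 2 := by rw [hr]; linear_combination (m * q) ^ 2 * hs'
    have e2 : (X * r) ^ 2 = j ^ 2 := by rw [hX']; ring
    have e3 : (1 + b * n) ^ 4 = d * d := by rw [hd]; ring
    rw [e3]
    linear_combination (d + y * d) * d * e1 - r * (y * d) * d * hX' + (y * d) * (d + y * d) * e2
      + (b * w * (m * q) ^ 2 * d + j * r * d + j ^ 2 * (d + y * d + Y)) * hy
  rw [h1, hr, hY, hd, hq, hj, hw, kernelCofactor]
  ring

theorem one_add_mul_sq (hy : y * (1 + b * n) ^ 2 = n * (1 + b ^ 3 * n) ^ 2) :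
    (1 + y) * (1 + b * n) ^ 2
      = (1 + b ^ 2 * n) * (b ^ 4 * n ^ 2 + (1 + 2 * b - b ^ 2) * n + 1) := by
  linear_combination hy

theorem kernel_relation_sq (hw : w = (1 + 3 * b) * (1 - b))
    (hX : 1 - w * m - b ^ 2 * w * m ^ 2
      + X * w * (1 + 3 * b) * m * (1 + w * b * m - b ^ 4 * w * m ^ 2) = 0)
    (hB : (n + b * w * m ^ 2) * (1 + b ^ 2 * n) - w * (1 - b) * m * n = 0)
    (uw : w ∈ nonZeroDivisors A) (um : m ∈ nonZeroDivisors A) :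
    X * (1 + 3 * b) * (1 + w * b * m - b ^ 4 * w * m ^ 2) ^ 2 * n * (1 + b ^ 2 * n) ^ 2
      = b * m * (1 + b * n) * (1 + b ^ 3 * n)
        * (b ^ 4 * n ^ 2 + (1 + 2 * b - b ^ 2) * n + 1) := by
  have h3 : (1 - w * m - b ^ 2 * w * m ^ 2) * (1 + w * b * m - b ^ 4 * w * m ^ 2) * n
      * (1 + b ^ 2 * n) ^ 2 + b * w * m ^ 2 * (1 + b * n) * (1 + b ^ 3 * n)
        * (b ^ 4 * n ^ 2 + (1 + 2 * b - b ^ 2) * n + 1) = 0 := by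
    have := congrArg (· * (1 + b ^ 2 * n - b ^ 2 * w * m * n + b ^ 3 * w * m * n
      + b ^ 5 * w * m ^ 2 * n + b ^ 7 * w * m ^ 2 * n ^ 2)) hB
    simp only [zero_mul] at this
    rw [← this, hw]
    ring
  rw [← sub_eq_zero, ← mul_right_mem_nonZeroDivisors_eq_zero_iff (mul_mem uw um)]
  linear_combination (1 + w * b * m - b ^ 4 * w * m ^ 2) * n * (1 + b ^ 2 * n) ^ 2 * hX - h3

theorem kernel_relation_lin (hw : w = (1 + 3 * b) * (1 - b))
    (hy : y * (1 + b * n) ^ 2 = n * (1 + b ^ 3 * n) ^ 2)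
    (hX : 1 - w * m - b ^ 2 * w * m ^ 2
      + X * w * (1 + 3 * b) * m * (1 + w * b * m - b ^ 4 * w * m ^ 2) = 0)
    (hB : (n + b * w * m ^ 2) * (1 + b ^ 2 * n) - w * (1 - b) * m * n = 0)
    (uq : 1 + w * b * m - b ^ 4 * w * m ^ 2 ∈ nonZeroDivisors A)
    (un : 1 + b * n ∈ nonZeroDivisors A) :
    (1 + b ^ 2 * n) * (n - b * w * m ^ 2) * (b ^ 4 * n ^ 2 + (3 * b ^ 3 - b) * n + 1)
      = -(w * (1 + 3 * b) * m * n * (1 + b ^ 3 * n) * (1 + b * n) * (2 * X * (1 + y) - 1)) := by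
  have h7 : (1 + b ^ 2 * n) * (n - b * w * m ^ 2) * (b ^ 4 * n ^ 2 + (3 * b ^ 3 - b) * n + 1)
        * ((1 + w * b * m - b ^ 4 * w * m ^ 2) * (1 + b * n))
      + n * (1 + b ^ 3 * n) * (-2 * (1 - w * m - b ^ 2 * w * m ^ 2)
        * ((1 + b ^ 2 * n) * (b ^ 4 * n ^ 2 + (1 + 2 * b - b ^ 2) * n + 1))
        - w * (1 + 3 * b) * m * (1 + w * b * m - b ^ 4 * w * m ^ 2) * (1 + b * n) ^ 2) = 0 := by
    have := congrArg (· * (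
      (-1 - b * (1 + 2 * b - 3 * b ^ 2) * m + b ^ 4 * (1 + 2 * b - 3 * b ^ 2) * m ^ 2)
      + (-(2 + 4 * b - 2 * b ^ 2 - b ^ 3) + b ^ 3 * (2 + 3 * b - 8 * b ^ 2 + 3 * b ^ 3) * m
        + b ^ 7 * (3 + 6 * b - 9 * b ^ 2) * m ^ 2) * n
      + (-b ^ 2 * (1 + 2 * b + 2 * b ^ 2 - 2 * b ^ 3)
        + b ^ 3 * (1 + 4 * b + b ^ 2 - 4 * b ^ 3 + 4 * b ^ 4 - 6 * b ^ 5) * m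
        - b ^ 6 * (1 + 2 * b - 7 * b ^ 2 - 8 * b ^ 3 + 12 * b ^ 4) * m ^ 2) * n ^ 2
      + (b ^ 5 * (1 - 2 * b ^ 2) + b ^ 6 * (1 + 4 * b + b ^ 2 - 6 * b ^ 3) * m
        + b ^ 9 * (1 + 2 * b - 3 * b ^ 2) * m ^ 2) * n ^ 3)) hB
    simp only [zero_mul] at this
    rw [← this, hw]
    ring
  rw [← one_add_mul_sq hy] at h7
  rw [← sub_eq_zero, ← mul_right_mem_nonZeroDivisors_eq_zero_iff (mul_mem uq un)]
  linear_combination h7 + 2 * n * (1 + b ^ 3 * n) * (1 + y) * (1 + b * n) ^ 2 * hX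

/-- The explicit solution satisfies the functional equation on the zero set of the kernel. -/
theorem solution_on_kernel {W Φ ψ : A} (hW : W ^ 2 = w) (hw : w = (1 + 3 * b) * (1 - b))
    (hs : s * (1 - b) * (1 + 3 * b) ^ 3 = b)
    (hy : y * (1 + b * n) ^ 2 = n * (1 + b ^ 3 * n) ^ 2)
    (hX : 1 - w * m - b ^ 2 * w * m ^ 2
      + X * w * (1 + 3 * b) * m * (1 + w * b * m - b ^ 4 * w * m ^ 2) = 0)
    (hκ : s * (1 + y) - X * y + X ^ 2 * y * (1 + y) = 0)
    (hΦ : Φ * ((1 + 3 * b) ^ 3 * (1 + w * b * m - b ^ 4 * w * m ^ 2) ^ 4)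
      = W * ((2 - w * (1 - b) * m + 2 * b ^ 3 * w * m ^ 2) * (b * (1 + b) ^ 6 * (1 - b) * m
        - (1 + b) ^ 2 * (1 + 4 * b - b ^ 2) * (1 + w * b * m - b ^ 4 * w * m ^ 2) ^ 2
          * X * (1 + 3 * b))))
    (hψ : ψ * (W * ((1 + 3 * b) * (1 + b ^ 3 * n) ^ 3 * (1 + b * n) ^ 3
        * (b ^ 4 * n ^ 2 + (3 * b ^ 3 - b) * n + 1)))
      = 2 * (1 - b) * (1 + b) ^ 2 * (1 - b ^ 2 * n) * (1 + b ^ 2 * n) ^ 3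
        * ((1 + 4 * b - b ^ 2) * (1 + b * n) * (1 + b ^ 3 * n)
            * (b ^ 4 * n ^ 2 + (1 + 2 * b - b ^ 2) * n + 1)
          - (1 + b) ^ 4 * (1 - b) * n * (1 + b ^ 2 * n) ^ 2))
    (uW : W ∈ nonZeroDivisors A) (um : m ∈ nonZeroDivisors A)
    (uc : kernelCofactor b m n ∈ nonZeroDivisors A)
    (ub : 1 + 3 * b ∈ nonZeroDivisors A)
    (uq : 1 + w * b * m - b ^ 4 * w * m ^ 2 ∈ nonZeroDivisors A)
    (un : 1 + b * n ∈ nonZeroDivisors A) (un2 : 1 + b ^ 2 * n ∈ nonZeroDivisors A)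
    (un3 : 1 + b ^ 3 * n ∈ nonZeroDivisors A)
    (uK : b ^ 4 * n ^ 2 + (3 * b ^ 3 - b) * n + 1 ∈ nonZeroDivisors A)
    (rX : X ∈ nonZeroDivisors A) (ry : y ∈ nonZeroDivisors A) (rn : n ∈ nonZeroDivisors A) :
    2 * (1 + y) * (1 - X * (1 + y)) * Φ - X * (2 * X * (1 + y) - 1) * ψ = 0 := by
  have uw : w ∈ nonZeroDivisors A := hW ▸ pow_mem uW 2
  have hB : (n + b * w * m ^ 2) * (1 + b ^ 2 * n) - w * (1 - b) * m * n = 0 := by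
    have := kernel_factor hw hs hy hX
    rw [hκ, zero_mul] at this
    exact (mul_right_mem_nonZeroDivisors_eq_zero_iff uc).1 this.symm
  have h1 : (2 - w * (1 - b) * m + 2 * b ^ 3 * w * m ^ 2) * n
      = (n - b * w * m ^ 2) * (1 - b ^ 2 * n) := by
    linear_combination hB
  have h6 := kernel_relation_sq hw hX hB uw um
  have h7 := kernel_relation_lin hw hy hX hB uq un
  have hd := one_add_mul_sq hy
  set q := 1 + w * b * m - b ^ 4 * w * m ^ 2
  set K₂ := b ^ 4 * n ^ 2 + (1 + 2 * b - b ^ 2) * n + 1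
  set K₃ := b ^ 4 * n ^ 2 + (3 * b ^ 3 - b) * n + 1
  set e := 2 - w * (1 - b) * m + 2 * b ^ 3 * w * m ^ 2
  set r := (1 + 4 * b - b ^ 2) * (1 + b * n) * (1 + b ^ 3 * n) * K₂
    - (1 + b) ^ 4 * (1 - b) * n * (1 + b ^ 2 * n) ^ 2 with hr
  have a1 : s * w * (w * (1 + 3 * b) ^ 2) = b * w := by
    rw [hw]; linear_combination (1 + 3 * b) * (1 - b) * hs
  set M := 2 * X * (1 + y) - 1
  set V := 1 + b ^ 2 * n
  set V' := 1 - b ^ 2 * n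
  set U₁ := (1 + 3 * b) ^ 3 * q ^ 4 with hU₁
  set U₂ := (1 + 3 * b) * (1 + b ^ 3 * n) ^ 3 * (1 + b * n) ^ 3 * K₃ with hU₂
  have h4 : e * (b * (1 + b) ^ 6 * (1 - b) * m
      - (1 + b) ^ 2 * (1 + 4 * b - b ^ 2) * q ^ 2 * X * (1 + 3 * b)) * (n * V ^ 2)
      = -(e * m * (1 + b) ^ 2 * b * r) := by
    rw [hr]
    linear_combination -e * (1 + b) ^ 2 * (1 + 4 * b - b ^ 2) * h6
  have uU₁ : U₁ ∈ nonZeroDivisors A := mul_mem (pow_mem ub 3) (pow_mem uq 4)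
  have uU₂ : U₂ ∈ nonZeroDivisors A :=
    mul_mem (mul_mem (mul_mem ub (pow_mem un3 3)) (pow_mem un 3)) uK
  set a := 1 + b
  set c := 1 - b
  set d := 1 + 3 * b
  set P := 1 + b * n
  set R := 1 + b ^ 3 * n
  set Y := 1 + y
  clear hr hB hs hX
  clear_value U₁ U₂ q K₂ K₃ e r M V V' a c d P R Y
  have hG : Y ^ 2 * s * w * e * m * b * U₂
      + X ^ 2 * y * M * U₁ * n * V ^ 5 * V' * c = 0 := by
    rw [← mul_right_mem_nonZeroDivisors_eq_zero_iff (mul_mem (mul_mem (mul_mem uw (pow_mem ub 2))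
      rn) (pow_mem un 4))]
    have a2 : (Y * P ^ 2) ^ 2 = (V * K₂) ^ 2 := by rw [hd]
    have a3 : (X * d * q ^ 2 * n * V ^ 2) ^ 2
        = (b * m * P * R * K₂) ^ 2 := by rw [h6]
    calc _ = (Y * P ^ 2) ^ 2 * (s * w * (w * d ^ 2)) * (e * n)
              * (m * b * U₂)
            + (X * d * q ^ 2 * n * V ^ 2) ^ 2 * (y * P ^ 2)
              * (M * w * d ^ 3 * V * V' * c * P ^ 2) := by
            rw [hU₁]; ring
      _ = K₂ ^ 2 * b ^ 2 * w * V' * m * d * R ^ 3 * P ^ 3 * V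
            * (V * (n - b * w * m ^ 2) * K₃)
          + (b * m * P * R * K₂) ^ 2 * (n * R ^ 2)
              * (M * w * d ^ 3 * V * V' * c * P ^ 2) := by
            rw [a1, a2, a3, h1, hy, hU₂]; ring
      _ = K₂ ^ 2 * b ^ 2 * w * V' * m ^ 2 * d ^ 2 * R ^ 4
            * P ^ 4 * V * n * M * (d * c - w) := by
            rw [h7]; ring
      _ = 0 := by rw [hw]; ring
  have uu : W * U₁ * U₂ * (n * V ^ 2) * (X * y) ∈ nonZeroDivisors A :=
    mul_mem (mul_mem (mul_mem (mul_mem uW uU₁) uU₂) (mul_mem rn (pow_mem un2 2))) (mul_mem rX ry)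
  rw [← mul_right_mem_nonZeroDivisors_eq_zero_iff uu]
  calc _ = 2 * Y * (X * y * (1 - X * Y)) * W * (Φ * U₁) * U₂ * (n * V ^ 2)
          - X ^ 2 * y * M * U₁ * (n * V ^ 2) * (ψ * (W * U₂)) := by ring
    _ = 2 * Y ^ 2 * s * W ^ 2 * U₂ * (-(e * m * a ^ 2 * b * r))
          - X ^ 2 * y * M * U₁ * (n * V ^ 2)
            * (2 * c * a ^ 2 * V' * V ^ 3 * r) := by
          rw [hΦ, hψ, ← h4]
          linear_combination -2 * Y * W * W * (e * (b * a ^ 6 * c * m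
            - a ^ 2 * (1 + 4 * b - b ^ 2) * q ^ 2 * X * d)) * (n * V ^ 2) * U₂ * hκ
    _ = 0 := by
          rw [hW]
          linear_combination -2 * a ^ 2 * r * hG

end KernelQuotient

theorem PowerSeries.exists_fixedPoint {A : Type*} [CommRing A] (F : A⟦X⟧ → A⟦X⟧)
    (hF : ∀ f g, X * (f - g) ∣ F f - F g) : ∃ f, F f = f := by
  have hstep : ∀ k f g, X ^ k ∣ f - g → X ^ (k + 1) ∣ F f - F g := fun k f g h =>
    (pow_succ' (X : A⟦X⟧) k ▸ mul_dvd_mul_left X h).trans (hF f g)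
  have hiter : ∀ k j, X ^ k ∣ F^[k + j] 0 - F^[k] 0 := by
    intro k
    induction k with
    | zero => simp
    | succ k ih =>
      intro j
      rw [Nat.succ_add, Function.iterate_succ_apply', Function.iterate_succ_apply']
      exact hstep k _ _ (ih j)
  let f : A⟦X⟧ := mk fun k => coeff k (F^[k + 1] 0)
  have hf : ∀ k, X ^ k ∣ f - F^[k] 0 := by
    intro k
    rw [X_pow_dvd_iff]
    intro m hm
    obtain ⟨j, rfl⟩ : ∃ j, k = m + 1 + j := ⟨k - (m + 1), by omega⟩
    have := X_pow_dvd_iff.1 (hiter (m + 1) j) m (Nat.lt_succ_self m)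
    rw [map_sub, sub_eq_zero] at this
    rw [map_sub, coeff_mk, this, sub_self]
  refine ⟨f, ?_⟩
  ext k
  have h1 := hstep k _ _ (hf k)
  have h2 := hf (k + 1)
  rw [Function.iterate_succ_apply'] at h2
  have h3 := X_pow_dvd_iff.1 (dvd_sub h1 h2) k (Nat.lt_succ_self k)
  simpa [sub_eq_zero] using h3

theorem exists_parameter :
    ∃ b : ℚ⟦X⟧, constantCoeff b = 0 ∧ X * (1 - b) * (1 + 3 * b) ^ 3 = b := by
  obtain ⟨b, hb⟩ := exists_fixedPoint (fun b : ℚ⟦X⟧ => X * (1 - b) * (1 + 3 * b) ^ 3)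
    fun f g => ⟨8 + 18 * (f + g) - 27 * (f ^ 3 + f ^ 2 * g + f * g ^ 2 + g ^ 3), by ring⟩
  exact ⟨b, by rw [← hb]; simp, hb⟩

theorem exists_sqrt_parameter {b : ℚ⟦X⟧} (hb : constantCoeff b = 0) :
    ∃ W : ℚ⟦X⟧, constantCoeff W = 1 ∧ W ^ 2 = (1 + 3 * b) * (1 - b) := by
  obtain ⟨c, rfl⟩ := X_dvd_iff.2 hb
  have h2 : (2 : ℚ⟦X⟧) * C (1 / 2) = 1 := by
    rw [show (2 : ℚ⟦X⟧) = C 2 from (map_ofNat C 2).symm, ← map_mul]; norm_num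
  obtain ⟨ω, hω⟩ := exists_fixedPoint
    (fun ω : ℚ⟦X⟧ => 1 - C (1 / 2) * (3 * (X * c) + X * c * ω ^ 2))
    fun f g => ⟨-C (1 / 2) * c * (f + g), by ring⟩
  refine ⟨1 + X * c * ω, by simp, ?_⟩
  have h3 : 2 * ω = 2 - 3 * (X * c) - X * c * ω ^ 2 := by
    linear_combination -2 * hω - (3 * (X * c) + X * c * ω ^ 2) * h2
  linear_combination X * c * h3

theorem exists_branch_x {A : Type*} [CommRing A] {b W p u : A} (hp : W = 2 * p - 1 - b)
    (hp2 : p ^ 2 = (1 + b) * p - b ^ 2) (hu : (1 + b) * p * u = 1) :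
    ∃ ϖ ε : A⟦X⟧, ϖ = C p + X * ε ∧
      ϖ * (ϖ ^ 2 - C W * ϖ - C b ^ 2) + X * C W * (1 + 3 * C b)
        * (ϖ ^ 2 + C W * C b * ϖ - C b ^ 4) = 0 := by
  replace hp := congrArg (C : A → A⟦X⟧) hp
  replace hp2 := congrArg (C : A → A⟦X⟧) hp2
  replace hu := congrArg (C : A → A⟦X⟧) hu
  simp only [map_mul, map_add, map_sub, map_pow, map_one, map_ofNat] at hp hp2 hu
  generalize (C b : A⟦X⟧) = b at *
  generalize (C p : A⟦X⟧) = p at *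
  generalize (C W : A⟦X⟧) = W at *
  generalize (C u : A⟦X⟧) = u at *
  obtain ⟨ε, hε⟩ := exists_fixedPoint (fun ε : A⟦X⟧ =>
    -u * (W * (1 + 3 * b) * ((p + X * ε) ^ 2 + W * b * (p + X * ε) - b ^ 4)
      + X * ε ^ 2 * (1 + b + p + X * ε)))
    fun f g => ⟨-u * (W * (1 + 3 * b) * (2 * p + X * (f + g) + W * b)
      + (f + g) * (1 + b + p) + X * (f ^ 2 + f * g + g ^ 2)), by ring⟩
  refine ⟨p + X * ε, ε, rfl, ?_⟩
  have h3 : (1 + b) * p * ε + (W * (1 + 3 * b) * ((p + X * ε) ^ 2 + W * b * (p + X * ε) - b ^ 4)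
      + X * ε ^ 2 * (1 + b + p + X * ε)) = 0 := by
    linear_combination -(1 + b) * p * hε - (W * (1 + 3 * b) * ((p + X * ε) ^ 2
      + W * b * (p + X * ε) - b ^ 4) + X * ε ^ 2 * (1 + b + p + X * ε)) * hu
  linear_combination X * h3 - (p + X * ε) ^ 2 * hp - (p + X * ε) * hp2

theorem exists_branch_y {A : Type*} [CommRing A] (b : A) :
    ∃ η : A⟦X⟧, constantCoeff η = 1 ∧
      X * (1 + C b * (X * η)) ^ 2 = X * η * (1 + C b ^ 3 * (X * η)) ^ 2 := by
  obtain ⟨η, hη⟩ := exists_fixedPoint (fun η : A⟦X⟧ =>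
    (1 + C b * (X * η)) ^ 2 - X * C b ^ 3 * η ^ 2 * (2 + C b ^ 3 * (X * η)))
    fun f g => ⟨C b * (2 + C b * X * (f + g)) - C b ^ 3 * (2 * (f + g)
      + C b ^ 3 * X * (f ^ 2 + f * g + g ^ 2)), by ring⟩
  refine ⟨η, by rw [← hη]; simp, ?_⟩
  linear_combination X * hη

theorem PowerSeries.C_dvd_of_map {A B : Type*} [CommRing A] [CommRing B] (φ : A →+* B) {a : A}
    (h : ∀ x, φ x = 0 → a ∣ x) {f : A⟦X⟧} (hf : PowerSeries.map φ f = 0) : C a ∣ f := by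
  choose g hg using fun k => h (coeff k f) (by rw [← coeff_map, hf, map_zero])
  exact ⟨mk g, by ext k; rw [coeff_C_mul, coeff_mk, hg]⟩

theorem mk_mem_nonZeroDivisors {R R' : Type*} [CommRing R] [IsDomain R] [CommRing R'] [IsDomain R']
    (φ : R →+* R') {x κ : R} (hx : x ≠ 0) (hφx : φ x = 0) (hφκ : φ κ ≠ 0)
    (h : ∀ g, φ g = 0 → x ∣ g) :
    Ideal.Quotient.mk (Ideal.span {κ}) x ∈ nonZeroDivisors (R ⧸ Ideal.span {κ}) := by
  rw [mem_nonZeroDivisors_iff_right]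
  intro f hf
  obtain ⟨f, rfl⟩ := Ideal.Quotient.mk_surjective f
  rw [← map_mul, Ideal.Quotient.eq_zero_iff_dvd] at hf
  rw [Ideal.Quotient.eq_zero_iff_dvd]
  obtain ⟨g, hg⟩ := hf
  have h0 := congrArg φ hg
  rw [map_mul, map_mul, hφx, mul_zero, eq_comm, mul_eq_zero] at h0
  obtain ⟨g', rfl⟩ := h g (h0.resolve_left hφκ)
  exact ⟨g', mul_right_cancel₀ hx (by rw [hg]; ring)⟩

theorem branch_sq_zero {A : Type*} [CommRing A] {b W p δ : A} (hδ : δ ^ 2 = 0)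
    (hp : W = 2 * p - 1 - b) (hp2 : p ^ 2 = (1 + b) * p - b ^ 2) :
    (1 - b) * ((2 * (p + δ) ^ 2 - W * (1 - b) * (p + δ) + 2 * b ^ 3)
        * (b * (1 + b) ^ 6 * (1 - b) * (p + δ) ^ 5
          + (1 + b) ^ 2 * (1 + 4 * b - b ^ 2) * ((p + δ) ^ 2 + W * b * (p + δ) - b ^ 4)
            * ((p + δ) ^ 2 - W * (p + δ) - b ^ 2) * (p + δ) ^ 3))
      - b * ((p + δ) ^ 2 + W * b * (p + δ) - b ^ 4) ^ 4
      - ((p + δ) ^ 2 - W * (p + δ) - b ^ 2) * W * (1 + 3 * b)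
        * ((p + δ) ^ 2 + W * b * (p + δ) - b ^ 4) ^ 3 * (p + δ) = 0 := by
  have hW : (p - b ^ 2) ^ 2 = (1 - b) * p ^ 3 := by
    linear_combination (b ^ 2 - (1 - b) * p) * hp2
  have hq : (p + δ) ^ 2 + W * b * (p + δ) - b ^ 4
      = (1 + b) ^ 2 * (p - b ^ 2) + (2 * p + W * b) * δ := by
    rw [hp]; linear_combination hδ + (1 + 2 * b) * hp2
  have hj : (p + δ) ^ 2 - W * (p + δ) - b ^ 2 = (1 + b) * δ := by
    rw [hp]; linear_combination hδ - hp2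
  have he : 2 * (p + δ) ^ 2 - W * (1 - b) * (p + δ) + 2 * b ^ 3
      = (1 + b) ^ 2 * p + (4 * p - W * (1 - b)) * δ := by
    rw [hp]; linear_combination 2 * hδ + 2 * b * hp2
  have hmul : ∀ x y z t : A, (x + y * δ) * (z + t * δ) = x * z + (x * t + y * z) * δ := by
    intro x y z t; linear_combination y * t * hδ
  have hsq : ∀ x y : A, (x + y * δ) ^ 2 = x ^ 2 + 2 * x * y * δ := by
    intro x y; linear_combination y ^ 2 * hδ
  have hcu : ∀ x y : A, (x + y * δ) ^ 3 = x ^ 3 + 3 * x ^ 2 * y * δ := by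
    intro x y; rw [pow_succ, hsq, hmul]; ring
  have h4 : ∀ x y : A, (x + y * δ) ^ 4 = x ^ 4 + 4 * x ^ 3 * y * δ := by
    intro x y; rw [pow_succ, hcu, hmul]; ring
  have h5 : ∀ x y : A, (x + y * δ) ^ 5 = x ^ 5 + 5 * x ^ 4 * y * δ := by
    intro x y; rw [pow_succ, h4, hmul]; ring
  have hd : ∀ x y : A, δ * (x + y * δ) = x * δ := by
    intro x y; linear_combination y * hδ
  have hp5 := h5 p 1
  have hp3 := hcu p 1
  rw [one_mul, mul_one] at hp5 hp3
  rw [hq, hj, he, hp5, hp3, h4, hcu]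
  have hf : (1 - b) * b * p ^ 2 * (5 * (1 + b) ^ 2 + 4 * p - W * (1 - b))
      + (1 + b) * (1 + 4 * b - b ^ 2) * (p - b ^ 2) * p - 4 * b * (p - b ^ 2) * (2 * p + W * b)
      - (1 + b) * W * (1 + 3 * b) * p * (p - b ^ 2) = 0 := by
    rw [hp]
    linear_combination (-2 * p - 6 * b * p - 6 * b ^ 2 * p - 2 * b ^ 3 * p - 4 * b ^ 2
      - 4 * b ^ 3) * hp2
  generalize hr : p - b ^ 2 = r at *
  generalize hB : 2 * p + W * b = B at *
  generalize hE : 4 * p - W * (1 - b) = E at *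
  have hE' : 5 * (1 + b) ^ 2 + 4 * p - W * (1 - b) = 5 * (1 + b) ^ 2 + E := by rw [← hE]; ring
  rw [hE'] at hf
  generalize ha : 1 + b = a at *
  generalize 1 + 3 * b = d at *
  generalize 1 + 4 * b - b ^ 2 = g at *
  generalize hc : 1 - b = c at *
  have e1 : (a ^ 2 * p + E * δ) * (b * a ^ 6 * c * (p ^ 5 + 5 * p ^ 4 * δ)
      + a ^ 2 * g * (a ^ 2 * r + B * δ) * (a * δ) * (p ^ 3 + 3 * p ^ 2 * δ))
      = a ^ 8 * b * c * p ^ 6 + (a ^ 6 * b * c * p ^ 5 * (5 * a ^ 2 + E)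
        + a ^ 7 * g * r * p ^ 4) * δ := by
    linear_combination (5 * E * b * a ^ 6 * c * p ^ 4 + a ^ 2 * p * a ^ 3 * g * (B * p ^ 3
      + a ^ 2 * r * 3 * p ^ 2 + B * 3 * p ^ 2 * δ) + E * a ^ 3 * g * (a ^ 2 * r + B * δ)
      * (p ^ 3 + 3 * p ^ 2 * δ)) * hδ
  have e2 : a * δ * W * d * ((a ^ 2 * r) ^ 3 + 3 * (a ^ 2 * r) ^ 2 * B * δ) * (p + δ)
      = a ^ 7 * W * d * r ^ 3 * p * δ := by
    linear_combination a * W * d * ((a ^ 2 * r) ^ 3 + 3 * (a ^ 2 * r) ^ 2 * B * (p + δ)) * hδ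
  rw [e1, e2]
  linear_combination -b * a ^ 8 * (r ^ 2 + c * p ^ 3) * hW
    + a ^ 6 * c * p ^ 3 * δ * hf
    - (4 * b * a ^ 6 * r * B * δ + a ^ 7 * W * d * r * p * δ) * hW

theorem solution_x_expansion {A : Type*} [CommRing A] {b W s X ϖ m Φ : A}
    (hW : W ^ 2 = (1 + 3 * b) * (1 - b)) (hs : s * (1 - b) * (1 + 3 * b) ^ 3 = b)
    (hm : W * ϖ * m = 1)
    (hrel : ϖ * (ϖ ^ 2 - W * ϖ - b ^ 2)
      + X * W * (1 + 3 * b) * (ϖ ^ 2 + W * b * ϖ - b ^ 4) = 0)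
    (hΦ : Φ * ((1 + 3 * b) ^ 3 * (1 + W ^ 2 * b * m - b ^ 4 * W ^ 2 * m ^ 2) ^ 4)
      = W * ((2 - W ^ 2 * (1 - b) * m + 2 * b ^ 3 * W ^ 2 * m ^ 2) * (b * (1 + b) ^ 6 * (1 - b) * m
        - (1 + b) ^ 2 * (1 + 4 * b - b ^ 2) * (1 + W ^ 2 * b * m - b ^ 4 * W ^ 2 * m ^ 2) ^ 2
          * X * (1 + 3 * b)))) :
    (1 - b) * (1 + 3 * b) ^ 3 * (ϖ ^ 2 + W * b * ϖ - b ^ 4) ^ 4 * (Φ - s + X)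
      = (1 - b) * ((2 * ϖ ^ 2 - W * (1 - b) * ϖ + 2 * b ^ 3)
          * (b * (1 + b) ^ 6 * (1 - b) * ϖ ^ 5
            + (1 + b) ^ 2 * (1 + 4 * b - b ^ 2) * (ϖ ^ 2 + W * b * ϖ - b ^ 4)
              * (ϖ ^ 2 - W * ϖ - b ^ 2) * ϖ ^ 3))
        - b * (ϖ ^ 2 + W * b * ϖ - b ^ 4) ^ 4
        - (ϖ ^ 2 - W * ϖ - b ^ 2) * W * (1 + 3 * b)
          * (ϖ ^ 2 + W * b * ϖ - b ^ 4) ^ 3 * ϖ := by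
  have hq : (1 + W ^ 2 * b * m - b ^ 4 * W ^ 2 * m ^ 2) * ϖ ^ 2 = ϖ ^ 2 + W * b * ϖ - b ^ 4 := by
    linear_combination (W * b * ϖ - b ^ 4 * (W * ϖ * m + 1)) * hm
  have he : (2 - W ^ 2 * (1 - b) * m + 2 * b ^ 3 * W ^ 2 * m ^ 2) * ϖ ^ 2
      = 2 * ϖ ^ 2 - W * (1 - b) * ϖ + 2 * b ^ 3 := by
    linear_combination (-W * (1 - b) * ϖ + 2 * b ^ 3 * (W * ϖ * m + 1)) * hm
  generalize 1 + W ^ 2 * b * m - b ^ 4 * W ^ 2 * m ^ 2 = q at *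
  generalize 2 - W ^ 2 * (1 - b) * m + 2 * b ^ 3 * W ^ 2 * m ^ 2 = e at *
  generalize ϖ ^ 2 + W * b * ϖ - b ^ 4 = Q at *
  generalize 2 * ϖ ^ 2 - W * (1 - b) * ϖ + 2 * b ^ 3 = E at *
  generalize ϖ ^ 2 - W * ϖ - b ^ 2 = J at *
  generalize 1 + 4 * b - b ^ 2 = g at *
  generalize 1 + 3 * b = d at *
  generalize hc : 1 - b = c at *
  generalize 1 + b = a at *
  have h1 : Φ * d ^ 3 * Q ^ 4 = E * (b * a ^ 6 * c * ϖ ^ 5 + a ^ 2 * g * Q * J * ϖ ^ 3) := by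
    rw [← hq, ← he]
    linear_combination ϖ ^ 8 * hΦ + e * b * a ^ 6 * c * ϖ ^ 7 * hm
      - e * a ^ 2 * g * q * ϖ ^ 6 * hrel - e * a ^ 2 * g * q * ϖ ^ 6 * X * W * d * hq
  have h2 : c * d ^ 3 * Q ^ 4 * X = -(J * W * d * Q ^ 3 * ϖ) := by
    linear_combination W * d * Q ^ 3 * hrel - d ^ 2 * Q ^ 4 * X * hW
  linear_combination c * h1 + h2 - Q ^ 4 * hs

theorem PowerSeries.exists_mul_eq_of_constantCoeff {A : Type*} [CommRing A] {g : A⟦X⟧}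
    (hg : IsUnit (constantCoeff g)) (f : A⟦X⟧) : ∃ h, h * g = f := by
  obtain ⟨u, rfl⟩ := isUnit_iff_constantCoeff.2 hg
  exact ⟨f * ↑u⁻¹, by simp⟩

/-- The part of the explicit solution depending on the first catalytic variable. -/
theorem exists_solution_x {b W : ℚ⟦X⟧} (hb : constantCoeff b = 0) (hW0 : constantCoeff W = 1)
    (hW : W ^ 2 = (1 + 3 * b) * (1 - b)) (hs : X * (1 - b) * (1 + 3 * b) ^ 3 = b) :
    ∃ m Φ u : ℚ⟦X⟧⟦X⟧, IsUnit m ∧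
      1 - C W ^ 2 * m - C b ^ 2 * C W ^ 2 * m ^ 2
        + X * C W ^ 2 * (1 + 3 * C b) * m * (1 + C W ^ 2 * C b * m -
            C b ^ 4 * C W ^ 2 * m ^ 2) = 0 ∧
      Φ * ((1 + 3 * C b) ^ 3 * (1 + C W ^ 2 * C b * m - C b ^ 4 * C W ^ 2 * m ^ 2) ^ 4)
        = C W * ((2 - C W ^ 2 * (1 - C b) * m + 2 * C b ^ 3 * C W ^ 2 * m ^ 2)
          * (C b * (1 + C b) ^ 6 * (1 - C b) * m
            - (1 + C b) ^ 2 * (1 + 4 * C b - C b ^ 2)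
              * (1 + C W ^ 2 * C b * m - C b ^ 4 * C W ^ 2 * m ^ 2) ^ 2 * X * (1 + 3 * C b))) ∧
      Φ = C X - X + X ^ 2 + 3 * X * u ∧ constantCoeff u = 0 := by
  let p : ℚ⟦X⟧ := C (1 / 2) * (W + 1 + b)
  have h2 : (2 : ℚ⟦X⟧) * C (1 / 2) = 1 := by
    rw [show (2 : ℚ⟦X⟧) = C 2 from (map_ofNat C 2).symm, ← map_mul]; norm_num
  have hp : W = 2 * p - 1 - b := by linear_combination -(W + 1 + b) * h2
  have hp0 : constantCoeff p = 1 := by simp [p, hb, hW0]; norm_num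
  have hp2 : p ^ 2 = (1 + b) * p - b ^ 2 := by
    have : (2 : ℚ⟦X⟧) ^ 2 * (p ^ 2 - ((1 + b) * p - b ^ 2)) = 0 := by
      rw [hp] at hW; linear_combination hW
    have h20 : (2 : ℚ⟦X⟧) ≠ 0 := by rintro h; simp [h] at h2
    simpa [sub_eq_zero, h20] using this
  obtain ⟨u, hu⟩ := (isUnit_iff_constantCoeff.2
    (by simp [hp0, hb] : IsUnit (constantCoeff ((1 + b) * p)))).exists_right_inv
  obtain ⟨ϖ, ε, hϖ, hrel⟩ := exists_branch_x hp hp2 hu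
  have hϖ0 : constantCoeff ϖ = p := by simp [hϖ]
  have uWϖ : IsUnit (C W * ϖ) := by
    simp [isUnit_iff_constantCoeff, hϖ0, hp0, hW0]
  obtain ⟨m, hm⟩ := uWϖ.exists_right_inv
  have hϖ' : ϖ ≠ 0 := by
    rintro rfl
    simp at hm
  have um : IsUnit m := IsUnit.of_mul_eq_one _ ((mul_comm _ _).trans hm)
  have hq : (1 + C W ^ 2 * C b * m - C b ^ 4 * C W ^ 2 * m ^ 2) * ϖ ^ 2
      = ϖ ^ 2 + C W * C b * ϖ - C b ^ 4 := by
    linear_combination (C W * C b * ϖ - C b ^ 4 * (C W * ϖ * m + 1)) * hm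
  have uq : IsUnit (ϖ ^ 2 + C W * C b * ϖ - C b ^ 4) := by
    simp [isUnit_iff_constantCoeff, hϖ0, hp0, hW0, hb]
  have uq' := isUnit_of_mul_isUnit_left (hq ▸ uq)
  obtain ⟨Φ, hΦ⟩ := PowerSeries.exists_mul_eq_of_constantCoeff
    (isUnit_iff_constantCoeff.1 (show IsUnit ((1 + 3 * C b) ^ 3
      * (1 + C W ^ 2 * C b * m - C b ^ 4 * C W ^ 2 * m ^ 2) ^ 4 : ℚ⟦X⟧⟦X⟧) from
      IsUnit.mul (IsUnit.pow _ (by simp [isUnit_iff_constantCoeff, hb])) (uq'.pow _)))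
    (C W * ((2 - C W ^ 2 * (1 - C b) * m + 2 * C b ^ 3 * C W ^ 2 * m ^ 2)
          * (C b * (1 + C b) ^ 6 * (1 - C b) * m
            - (1 + C b) ^ 2 * (1 + 4 * C b - C b ^ 2)
              * (1 + C W ^ 2 * C b * m - C b ^ 4 * C W ^ 2 * m ^ 2) ^ 2 * X * (1 + 3 * C b))))
  have hW' := congrArg (C : _ → ℚ⟦X⟧⟦X⟧) hW
  have hs' := congrArg (C : _ → ℚ⟦X⟧⟦X⟧) hs
  simp only [map_mul, map_add, map_sub, map_pow, map_one, map_ofNat] at hW' hs'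
  have hexp := solution_x_expansion hW' hs' hm hrel hΦ
  have hdvd : X ^ 2 ∣ Φ - C X + X := by
    have uu : IsUnit ((1 - C b) * (1 + 3 * C b) ^ 3 * (ϖ ^ 2 + C W * C b * ϖ - C b ^ 4) ^ 4) :=
      (IsUnit.mul (by simp [isUnit_iff_constantCoeff, hb])
        (IsUnit.pow _ (by simp [isUnit_iff_constantCoeff, hb]))).mul (uq.pow _)
    rw [← uu.dvd_mul_left, hexp, ← Ideal.Quotient.eq_zero_iff_dvd]
    have hp' := congrArg (fun t => Ideal.Quotient.mk (Ideal.span {(X : ℚ⟦X⟧⟦X⟧) ^ 2}) (C t)) hp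
    have hp2' := congrArg (fun t => Ideal.Quotient.mk (Ideal.span {(X : ℚ⟦X⟧⟦X⟧) ^ 2}) (C t)) hp2
    have hδ : Ideal.Quotient.mk (Ideal.span {(X : ℚ⟦X⟧⟦X⟧) ^ 2}) (X * ε) ^ 2 = 0 := by
      rw [← map_pow, Ideal.Quotient.eq_zero_iff_dvd]
      exact ⟨ε ^ 2, by ring⟩
    simp only [map_mul, map_add, map_sub, map_pow, map_one, map_ofNat] at hp' hp2' hδ
    simp only [hϖ, map_mul, map_add, map_sub, map_pow, map_one, map_ofNat]
    exact branch_sq_zero hδ hp' hp2'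
  obtain ⟨g, hg⟩ := hdvd
  have h3 : (3 : ℚ⟦X⟧⟦X⟧) * C (C (1 / 3)) = 1 := by
    rw [show (3 : ℚ⟦X⟧⟦X⟧) = C (C 3) by simp only [map_ofNat], ← map_mul, ← map_mul]; norm_num
  refine ⟨m, Φ, X * (C (C (1 / 3)) * (g - 1)), um, ?_, hΦ, ?_, by simp⟩
  · rw [← mul_right_inj' (pow_ne_zero 3 hϖ'), mul_zero, ← hrel]
    linear_combination X * C W ^ 2 * (1 + 3 * C b) * m * ϖ * hq
      + (X * C W * (1 + 3 * C b) * (ϖ ^ 2 + C W * C b * ϖ - C b ^ 4)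
        - ϖ ^ 2 * C W - C b ^ 2 * ϖ * (C W * ϖ * m + 1)) * hm
  · linear_combination hg - X ^ 2 * (g - 1) * h3

/-- The part of the explicit solution depending on the second catalytic variable. -/
theorem exists_solution_y {b W : ℚ⟦X⟧} (hb : constantCoeff b = 0) (hW0 : constantCoeff W = 1) :
    ∃ n η ψ D : ℚ⟦X⟧⟦X⟧, n = X * η ∧ constantCoeff η = 1 ∧
      X * (1 + C b * n) ^ 2 = n * (1 + C b ^ 3 * n) ^ 2 ∧
      ψ * (C W * ((1 + 3 * C b) * (1 + C b ^ 3 * n) ^ 3 * (1 + C b * n) ^ 3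
          * (C b ^ 4 * n ^ 2 + (3 * C b ^ 3 - C b) * n + 1)))
        = 2 * (1 - C b) * (1 + C b) ^ 2 * (1 - C b ^ 2 * n) * (1 + C b ^ 2 * n) ^ 3
          * ((1 + 4 * C b - C b ^ 2) * (1 + C b * n) * (1 + C b ^ 3 * n)
              * (C b ^ 4 * n ^ 2 + (1 + 2 * C b - C b ^ 2) * n + 1)
            - (1 + C b) ^ 4 * (1 - C b) * n * (1 + C b ^ 2 * n) ^ 2) ∧
      ψ = 2 + 3 * C X * (1 + X) ^ 2 * D := by
  obtain ⟨η, hη0, hη⟩ := exists_branch_y b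
  obtain ⟨ψ, hψ⟩ := PowerSeries.exists_mul_eq_of_constantCoeff
    (show IsUnit (constantCoeff (C W * ((1 + 3 * C b) * (1 + C b ^ 3 * (X * η)) ^ 3
        * (1 + C b * (X * η)) ^ 3
        * (C b ^ 4 * (X * η) ^ 2 + (3 * C b ^ 3 - C b) * (X * η) + 1)) : ℚ⟦X⟧⟦X⟧)) by
      simp [isUnit_iff_constantCoeff, hb, hW0])
    (2 * (1 - C b) * (1 + C b) ^ 2 * (1 - C b ^ 2 * (X * η)) * (1 + C b ^ 2 * (X * η)) ^ 3
      * ((1 + 4 * C b - C b ^ 2) * (1 + C b * (X * η)) * (1 + C b ^ 3 * (X * η))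
          * (C b ^ 4 * (X * η) ^ 2 + (1 + 2 * C b - C b ^ 2) * (X * η) + 1)
        - (1 + C b) ^ 4 * (1 - C b) * (X * η) * (1 + C b ^ 2 * (X * η)) ^ 2))
  have hdvd : C X ∣ ψ - 2 := by
    refine PowerSeries.C_dvd_of_map constantCoeff (fun x => X_dvd_iff.2) ?_
    have := congrArg (PowerSeries.map (constantCoeff (R := ℚ))) hψ
    simp only [map_mul, map_add, map_sub, map_pow, map_one, map_ofNat, map_C, map_X, hb, hW0,
      map_zero] at this ⊢
    linear_combination this
  obtain ⟨g, hg⟩ := hdvd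
  obtain ⟨D, hD⟩ := PowerSeries.exists_mul_eq_of_constantCoeff
    (show IsUnit (constantCoeff (C (C 3) * (1 + X) ^ 2 : ℚ⟦X⟧⟦X⟧)) by
      simp) g
  simp only [map_ofNat] at hD
  exact ⟨X * η, η, ψ, D, rfl, hη0, hη, hψ, by linear_combination hg - C X * hD⟩

theorem map_kernelCofactor {A B : Type*} [CommRing A] [CommRing B] (φ : A →+* B) (b m n : A) :
    φ (kernelCofactor b m n) = kernelCofactor (φ b) (φ m) (φ n) := by
  simp only [kernelCofactor, map_add, map_sub, map_mul, map_pow, map_one, map_ofNat]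

theorem mk_mem_nonZeroDivisors_of_constantCoeff {κ f : ℚ⟦X⟧⟦X⟧⟦X⟧}
    (hf : constantCoeff (constantCoeff (constantCoeff f)) ≠ 0) :
    Ideal.Quotient.mk (Ideal.span {κ}) f
      ∈ nonZeroDivisors (ℚ⟦X⟧⟦X⟧⟦X⟧ ⧸ Ideal.span {κ}) :=
  ((isUnit_iff_constantCoeff.2 (isUnit_iff_constantCoeff.2 (isUnit_iff_constantCoeff.2
    hf.isUnit))).map (Ideal.Quotient.mk (Ideal.span {κ}))).mem_nonZeroDivisors

/-- Existence of a power series solution of the functional equation of the half-cone walks. -/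
theorem exists_functional_solution {b W : ℚ⟦X⟧} (hb : constantCoeff b = 0)
    (hW0 : constantCoeff W = 1) (hW : W ^ 2 = (1 + 3 * b) * (1 - b))
    (hs : X * (1 - b) * (1 + 3 * b) ^ 3 = b) :
    ∃ (u D : ℚ⟦X⟧⟦X⟧) (Λ : ℚ⟦X⟧⟦X⟧⟦X⟧), constantCoeff u = 0 ∧
      (2 + 3 * X * constantCoeff D) * (W * (1 + 3 * b))
        = 2 * (1 - b) * (1 + b) ^ 2 * (1 + 4 * b - b ^ 2) ∧
      2 * C X * X * (C (C X) + C X ^ 2) - 6 * C (C X) * C u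
        + 3 * C (C X) * (1 + X) * (C X ^ 2 * X - C (C X)) * PowerSeries.map C D
        + (C (C X) * (1 + X) - C X * X + C X ^ 2 * X * (1 + X)) * Λ = 0 := by
  obtain ⟨m, Φ, u, um, hX, hΦ, hu, hu0⟩ := exists_solution_x hb hW0 hW hs
  obtain ⟨n, η, ψ, D, hn, hη, hy, hψ, hD⟩ := exists_solution_y hb hW0
  have hn0 : constantCoeff n = 0 := by simp [hn]
  have hm0 : constantCoeff (constantCoeff m) ≠ 0 :=
    ((um.map constantCoeff).map constantCoeff).ne_zero
  let κ : ℚ⟦X⟧⟦X⟧⟦X⟧ := C (C X) * (1 + X) - C X * X + C X ^ 2 * X * (1 + X)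
  let π := Ideal.Quotient.mk (Ideal.span {κ})
  have hκ : π κ = 0 := Ideal.Quotient.eq_zero_iff_dvd _ _ |>.2 dvd_rfl
  have hCX : ∀ {A : Type} [CommRing A] [Nontrivial A], (C X : A⟦X⟧⟦X⟧) ≠ 0 := fun {A} _ _ =>
    (map_ne_zero_iff _ C_injective).2 X_ne_zero
  have ry : π X ∈ nonZeroDivisors _ :=
    mk_mem_nonZeroDivisors (constantCoeff : ℚ⟦X⟧⟦X⟧⟦X⟧ →+* _) X_ne_zero (by simp)
      (by simpa [κ] using hCX) fun g => X_dvd_iff.2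
  have rX : π (C X) ∈ nonZeroDivisors _ :=
    mk_mem_nonZeroDivisors (PowerSeries.map (constantCoeff : ℚ⟦X⟧⟦X⟧ →+* _))
      hCX (by simp)
      (by simp only [κ, map_add, map_sub, map_mul, map_pow, map_one, map_C, map_X, constantCoeff_C,
            constantCoeff_X, map_zero]
          intro h
          have := congrArg constantCoeff h
          simp at this)
      fun g => PowerSeries.C_dvd_of_map _ fun x => X_dvd_iff.2
  have hφy : ∀ f : ℚ⟦X⟧⟦X⟧, constantCoeff (PowerSeries.map (C : ℚ⟦X⟧ →+* ℚ⟦X⟧⟦X⟧) f)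
      = C (constantCoeff f) := fun f => by
    rw [← coeff_zero_eq_constantCoeff_apply, coeff_map, coeff_zero_eq_constantCoeff_apply]
  have rn : π (PowerSeries.map C n) ∈ nonZeroDivisors _ := by
    rw [hn, map_mul, map_mul, map_X]
    exact mul_mem ry (mk_mem_nonZeroDivisors_of_constantCoeff (by simp [hφy, hη]))
  have hN : π (2 * (1 + X) * (1 - C X * (1 + X)) * C Φ
      - C X * (2 * C X * (1 + X) - 1) * PowerSeries.map C ψ) = 0 := by
    have hs' := congrArg (fun f => π (C (C f))) hs
    have hW' := congrArg (fun f => π (C (C f))) hW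
    have hX' := congrArg (fun f => π (C f)) hX
    have hΦ' := congrArg (fun f => π (C f)) hΦ
    have hy' := congrArg (fun f => π (PowerSeries.map C f)) hy
    have hψ' := congrArg (fun f => π (PowerSeries.map C f)) hψ
    simp only [κ, map_mul, map_add, map_sub, map_pow, map_one, map_ofNat, map_C, map_X, map_zero]
      at hκ hs' hW' hX' hΦ' hy' hψ' ⊢
    refine solution_on_kernel rfl hW' hs' hy' hX' hκ hΦ' hψ' ?_ ?_ ?_ ?_ ?_ ?_ ?_ ?_ ?_ rX ry rn
    · exact mk_mem_nonZeroDivisors_of_constantCoeff (by simp [hW0])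
    · exact mk_mem_nonZeroDivisors_of_constantCoeff (by simpa using hm0)
    · rw [← map_kernelCofactor]
      refine mk_mem_nonZeroDivisors_of_constantCoeff ?_
      simp [hφy, hn0, hb, kernelCofactor]
    all_goals
      simp only [← map_ofNat π, ← map_one π, ← map_mul, ← map_add, ← map_sub, ← map_pow]
      refine mk_mem_nonZeroDivisors_of_constantCoeff ?_
      simp [hφy, hn0, hb]
  rw [Ideal.Quotient.eq_zero_iff_dvd] at hN
  set rhs : ℚ⟦X⟧⟦X⟧⟦X⟧ := 2 * C X * X * (C (C X) + C X ^ 2) - 6 * C (C X) * C u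
        + 3 * C (C X) * (1 + X) * (C X ^ 2 * X - C (C X)) * PowerSeries.map C D with hrhs
  have hdvd : κ ∣ rhs := by
    have u1 : IsUnit ((1 + X : ℚ⟦X⟧⟦X⟧⟦X⟧) ^ 2) :=
      IsUnit.pow _ (isUnit_iff_constantCoeff.2 (by simp))
    rw [← u1.dvd_mul_left]
    have hΦu := congrArg (C : _ → ℚ⟦X⟧⟦X⟧⟦X⟧) hu
    have hψD := congrArg (PowerSeries.map (C : ℚ⟦X⟧ →+* ℚ⟦X⟧⟦X⟧)) hD
    simp only [map_mul, map_add, map_sub, map_pow, map_one, map_ofNat, map_C, map_X] at hΦu hψD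
    rw [hΦu, hψD] at hN
    have : (1 + X) ^ 2 * rhs = κ * (2 * X - 6 * (1 + X) * C u
          - 3 * C (C X) * (1 + X) ^ 2 * PowerSeries.map C D)
        - X * (2 * (1 + X) * (1 - C X * (1 + X)) * (C (C X) - C X + C X ^ 2 + 3 * C X * C u)
          - C X * (2 * C X * (1 + X) - 1)
            * (2 + 3 * C (C X) * (1 + X) ^ 2 * PowerSeries.map C D)) := by
      rw [hrhs]; ring
    rw [this]
    exact dvd_sub (dvd_mul_right _ _) (hN.mul_left _)
  obtain ⟨Λ, hΛ⟩ := hdvd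
  refine ⟨u, D, -Λ, hu0, ?_, by linear_combination hΛ - hrhs⟩
  have := congrArg constantCoeff hψ
  rw [hD] at this
  simp only [map_mul, map_add, map_sub, map_pow, map_one, map_ofNat, constantCoeff_C,
    constantCoeff_X, hn0] at this
  linear_combination this

theorem half_cone_unique {l lam : ℕ → ℕ → ℕ → ℚ}
    (h0 : ∀ a i, l 0 a i = if i = 0 ∧ (a = 0 ∨ a = 2) then 1 / 3 else 0)
    (hl : ∀ n a i, l (n + 1) a i = l n (a + 1) i + l n (a + 1) (i + 1)
      + if a = 0 then 0 else (if a = 1 then 2 else 1)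
        * (l n (a - 1) i + if i = 0 then 0 else l n (a - 1) (i - 1)))
    (hlam : ∀ a i k, lam a i k
      = (if i = 0 ∧ (a = 0 ∧ k = 1 ∨ a = 2 ∧ k = 0) then 2 else 0)
        + (if k = 0 then 0 else lam (a + 1) i (k - 1) + lam (a + 1) (i + 1) (k - 1))
        + if a = 0 then 0 else (if a = 1 then 2 else 1)
          * (lam (a - 1) i k + if i = 0 then 0 else lam (a - 1) (i - 1) k)) :
    ∀ n a i k, a + 2 * k = n + 2 → lam a i k = 6 * l n a i := by
  have z0 : ∀ i, lam 0 i 0 = 0 := fun i => by rw [hlam]; simp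
  have z1 : ∀ i, lam 1 i 0 = 0 := fun i => by rw [hlam]; simp [z0]
  have hsupp : ∀ n a i, n + 2 < a → l n a i = 0 := by
    intro n
    induction n with
    | zero =>
      intro a i ha
      rw [h0, if_neg (by omega)]
    | succ n ih =>
      intro a i ha
      rw [hl, ih _ _ (by omega), ih _ _ (by omega), ih (a - 1) _ (by omega),
        ih (a - 1) _ (by omega)]
      simp
  intro n
  induction n with
  | zero =>
    intro a i k h
    obtain ⟨rfl, rfl⟩ | ⟨rfl, rfl⟩ : (a = 0 ∧ k = 1) ∨ (a = 2 ∧ k = 0) := by omega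
    · rw [hlam, h0]
      simp [z1]
      split_ifs <;> norm_num
    · rw [hlam, h0]
      simp [z1]
      split_ifs <;> norm_num
  | succ n ih =>
    intro a i k h
    rw [hlam, hl, if_neg (by omega), zero_add, mul_add 6 (_ + _)]
    congr 1
    · rcases k with _ | k
      · rw [hsupp n _ _ (by omega), hsupp n _ _ (by omega)]
        simp
      · rw [if_neg (by omega), ih _ _ _ (by omega), ih _ _ _ (by omega)]
        ring
    · rcases a with _ | a
      · simp
      · rw [if_neg a.succ_ne_zero, if_neg a.succ_ne_zero, ih _ _ _ (by omega),
          ih _ _ _ (by omega)]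
        split_ifs <;> ring

theorem coeff_functional_solution {u D : ℚ⟦X⟧⟦X⟧} {Λ : ℚ⟦X⟧⟦X⟧⟦X⟧}
    (hu : constantCoeff u = 0)
    (h : 2 * C X * X * (C (C X) + C X ^ 2) - 6 * C (C X) * C u
        + 3 * C (C X) * (1 + X) * (C X ^ 2 * X - C (C X)) * PowerSeries.map C D
        + (C (C X) * (1 + X) - C X * X + C X ^ 2 * X * (1 + X)) * Λ = 0) :
    (∀ i, coeff 0 (coeff i Λ) = X * (3 * coeff i D)) ∧
    ∀ a i k, coeff k (coeff a (coeff i Λ))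
      = (if i = 0 ∧ (a = 0 ∧ k = 1 ∨ a = 2 ∧ k = 0) then 2 else 0)
        + (if k = 0 then 0 else coeff (k - 1) (coeff (a + 1) (coeff i Λ))
          + coeff (k - 1) (coeff (a + 1) (coeff (i + 1) Λ)))
        + if a = 0 then 0 else (if a = 1 then 2 else 1)
          * (coeff k (coeff (a - 1) (coeff i Λ))
            + if i = 0 then 0 else coeff k (coeff (a - 1) (coeff (i - 1) Λ))) := by
  have hD : ∀ i, coeff 0 (coeff i Λ) = X * (3 * coeff i D) := by
    have h1 := congrArg (PowerSeries.map (constantCoeff (R := ℚ⟦X⟧))) h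
    have h2 : PowerSeries.map (constantCoeff (R := ℚ⟦X⟧)) (PowerSeries.map C D) = D := by
      ext i : 1; simp
    simp only [map_mul, map_add, map_sub, map_pow, map_one, map_ofNat, map_C, map_X, map_zero, h2,
      constantCoeff_C, constantCoeff_X, hu] at h1
    have h3 : C X * (1 + X) * (PowerSeries.map constantCoeff Λ - C X * (3 * D)) = 0 := by
      linear_combination h1
    have h4 : (C X * (1 + X) : ℚ⟦X⟧⟦X⟧) ≠ 0 := by
      refine mul_ne_zero ((map_ne_zero_iff _ C_injective).2 X_ne_zero) fun h => ?_
      simpa using congrArg constantCoeff h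
    have h5 := sub_eq_zero.1 ((mul_eq_zero.1 h3).resolve_left h4)
    intro i
    have h6 := congrArg (coeff i) h5
    rw [coeff_map, coeff_C_mul, show (3 : ℚ⟦X⟧⟦X⟧) = C 3 from (map_ofNat C 3).symm,
      coeff_C_mul] at h6
    simpa using h6
  refine ⟨hD, fun a i k => ?_⟩
  have h1 : X * (C (2 * X * (C X + X ^ 2)) + C (3 * C X * X ^ 2) * PowerSeries.map C D
      + C (3 * C X * X ^ 2) * (X * PowerSeries.map C D) - C (3 * C X ^ 2) * PowerSeries.map C D
      - C X * Λ + C (C X) * Λ + C (X ^ 2) * Λ + C (X ^ 2) * (X * Λ))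
      - C (6 * C X * u) - C (3 * C X ^ 2) * PowerSeries.map C D + C (C X) * Λ = 0 := by
    simp only [map_mul, map_add, map_pow, map_ofNat]
    linear_combination h
  have h2 := congrArg (coeff (i + 1)) h1
  have hC : ∀ f : ℚ⟦X⟧⟦X⟧, coeff (i + 1) (C f) = 0 := fun f => by
    rw [coeff_C, if_neg (Nat.succ_ne_zero i)]
  simp only [map_add, map_sub, coeff_succ_X_mul, coeff_C_mul, coeff_map, hC, map_zero] at h2
  have hE : ∀ j, (3 * C X * C (coeff j D) : ℚ⟦X⟧⟦X⟧) = C (coeff 0 (coeff j Λ)) := fun j => by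
    rw [hD, map_mul, map_mul, map_ofNat]
    ring
  have h3 : X * coeff i Λ = (if i = 0 then 2 * C X * X + 2 * X ^ 3 else 0)
      + C X * (coeff i Λ + coeff (i + 1) Λ)
      - C X * (C (coeff 0 (coeff i Λ)) + C (coeff 0 (coeff (i + 1) Λ)))
      + X ^ 2 * (coeff i Λ + C (coeff 0 (coeff i Λ))
        + if i = 0 then 0 else coeff (i - 1) Λ + C (coeff 0 (coeff (i - 1) Λ))) := by
    rcases i with _ | i
    · simp only [coeff_zero_X_mul, coeff_C, if_true] at h2 ⊢
      linear_combination (-1 : ℚ⟦X⟧⟦X⟧) * h2 + (X ^ 2 - C X) * hE 0 - C X * hE 1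
    · simp only [coeff_succ_X_mul, coeff_map, coeff_C, Nat.succ_ne_zero, if_false,
        Nat.add_sub_cancel] at h2 ⊢
      linear_combination (-1 : ℚ⟦X⟧⟦X⟧) * h2 + (X ^ 2 - C X) * hE (i + 1) - C X * hE (i + 2)
        + X ^ 2 * hE i
  have h4 := congrArg (coeff k) (congrArg (coeff (a + 1)) h3)
  rw [coeff_succ_X_mul] at h4
  rw [h4]
  have hX2 : ∀ (m : ℕ) (f : ℚ⟦X⟧⟦X⟧), coeff (m + 2) (X ^ 2 * f) = coeff m f := fun m f => by
    rw [pow_two, mul_assoc, coeff_succ_X_mul, coeff_succ_X_mul]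
  have hX1 : ∀ f : ℚ⟦X⟧⟦X⟧, coeff 1 (X ^ 2 * f) = 0 := fun f => by
    rw [pow_two, mul_assoc, coeff_succ_X_mul, coeff_zero_X_mul]
  have hX0 : coeff (a + 1) (2 * C X * X + 2 * X ^ 3 : ℚ⟦X⟧⟦X⟧)
      = (if a = 0 then 2 * X else 0) + if a = 2 then 2 else 0 := by
    rw [show (2 * C X * X + 2 * X ^ 3 : ℚ⟦X⟧⟦X⟧) = X * (C (2 * X) + C 2 * X ^ 2) by
      rw [map_mul, map_ofNat]; ring, coeff_succ_X_mul, map_add, coeff_C, coeff_C_mul, coeff_X_pow]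
    split_ifs <;> simp
  have hC' : ∀ f : ℚ⟦X⟧, coeff (a + 1) (C f) = 0 := fun f => by
    rw [coeff_C, if_neg a.succ_ne_zero]
  have h2C : ∀ m : ℕ, coeff m (2 : ℚ⟦X⟧) = if m = 0 then 2 else 0 := fun m => by
    rw [← map_ofNat C 2, coeff_C]
  have hsrc : coeff k (coeff (a + 1) (if i = 0 then 2 * C X * X + 2 * X ^ 3 else 0 : ℚ⟦X⟧⟦X⟧))
      = if i = 0 ∧ (a = 0 ∧ k = 1 ∨ a = 2 ∧ k = 0) then 2 else 0 := by
    rcases eq_or_ne i 0 with rfl | hi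
    · rw [if_pos rfl, hX0]
      rcases k with _ | _ | k <;> rcases a with _ | _ | _ | a <;> simp [h2C]
    · simp [hi]
  have hk : coeff k (coeff (a + 1) (C X * (coeff i Λ + coeff (i + 1) Λ)))
      = if k = 0 then 0 else coeff (k - 1) (coeff (a + 1) (coeff i Λ))
          + coeff (k - 1) (coeff (a + 1) (coeff (i + 1) Λ)) := by
    rw [coeff_C_mul, map_add]
    rcases k with _ | k
    · simp
    · simp [coeff_succ_X_mul]
  have hz : coeff (a + 1) (C X * (C (coeff 0 (coeff i Λ)) + C (coeff 0 (coeff (i +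
      1) Λ)))) = 0 := by
    rw [coeff_C_mul, map_add, hC', hC', add_zero, mul_zero]
  rw [map_add, map_sub, map_add, hz, map_add, map_sub, map_add, hsrc, hk, map_zero, sub_zero]
  congr 1
  rcases a with _ | _ | a
  · simp [hX1]
  · rw [hX2]
    rcases i with _ | i <;> simp <;> ring
  · rw [hX2]
    rcases i with _ | i <;> simp

theorem half_cone_count {l : ℕ → ℕ → ℕ → ℚ}
    (h0 : ∀ a i, l 0 a i = if i = 0 ∧ (a = 0 ∨ a = 2) then 1 / 3 else 0)
    (hl : ∀ n a i, l (n + 1) a i = l n (a + 1) i + l n (a + 1) (i + 1)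
      + if a = 0 then 0 else (if a = 1 then 2 else 1)
        * (l n (a - 1) i + if i = 0 then 0 else l n (a - 1) (i - 1))) (n : ℕ) :
    6 * l (2 * n) 0 0 = 4 * 16 ^ n / 81 *
      (4 * (24 * (n : ℚ) ^ 2 + 60 * n + 29) *
          (poch (1 / 2) n * poch (7 / 6) n) / (poch 2 (n + 1) * poch (4 / 3) (n + 1))
        - 2 * (12 * (n : ℚ) ^ 2 + 30 * n + 5) *
          (poch (1 / 2) n * poch (5 / 6) n) / (poch 2 (n + 1) * poch (5 / 3) (n + 1))) := by
  obtain ⟨b, hb, hs⟩ := exists_parameter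
  obtain ⟨W, hW0, hW⟩ := exists_sqrt_parameter hb
  obtain ⟨u, D, Λ, hu, hP, h⟩ := exists_functional_solution hb hW0 hW hs
  obtain ⟨hD, hΛ⟩ := coeff_functional_solution hu h
  obtain ⟨v, hv⟩ : ∃ v : ℚ⟦X⟧, (1 - b) * v = 1 :=
    ⟨(1 - b)⁻¹, PowerSeries.mul_inv_cancel _ (by simp [hb])⟩
  have hv0 : constantCoeff v = 1 := by simpa [hb] using congrArg constantCoeff hv
  have hq : (W * v) ^ 2 = (1 + 3 * b) * v := by
    linear_combination v ^ 2 * hW + (1 + 3 * b) * v * hv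
  have hq1 : (1 + 3 * b) * v - 1 = 4 * b * v := by linear_combination hv
  have hq2 : (1 + 3 * b) * v + 1 = 2 * (1 + b) * v := by linear_combination -hv
  have hq3 : (1 + 3 * b) * v + 3 = 4 * v := by linear_combination -3 * hv
  have hq4 : ((1 + 3 * b) * v) ^ 2 + 4 * ((1 + 3 * b) * v) - 1
      = 4 * (1 + 4 * b - b ^ 2) * v ^ 2 := by
    linear_combination ((1 - b) * v + 1 - 4 * (1 + 3 * b) * v) * hv
  rw [← half_cone_unique h0 hl (lam := fun a i k => coeff k (coeff a (coeff i Λ))) hΛ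
      (2 * n) 0 0 (n + 1) (by ring), hD 0, coeff_succ_X_mul,
    ← coeff_hyper_combination (Z := W * v) (P := 2 + 3 * X * constantCoeff D)]
  · rw [mul_assoc, mul_left_comm, ← map_ofNat C 2, map_add, coeff_C, if_neg n.succ_ne_zero,
      coeff_succ_X_mul, zero_add]
    simp
  · simp [hW0, hv0]
  · rw [show (W * v) ^ 6 = ((W * v) ^ 2) ^ 3 by ring, hq, hq1, hq3]
    linear_combination 256 * v ^ 4 * hs - 256 * X * (1 + 3 * b) ^ 3 * v ^ 3 * hv
  · rw [show (W * v) ^ 4 = ((W * v) ^ 2) ^ 2 by ring, hq, hq2, hq3, hq4,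
      show (W * v) ^ 3 * (4 * v) ^ 3 = 64 * W ^ 2 * W * v ^ 6 by ring, hW]
    linear_combination 64 * (1 - b) * v ^ 6 * hP
      + 128 * (1 + b) ^ 2 * (1 + 4 * b - b ^ 2) * v ^ 4 * ((1 - b) * v + 1) * hv

/-- The walks enumerated by `walkCount`. -/
abbrev Walks (S R : Set (ℤ × ℤ)) (a b : ℤ × ℤ) (n : ℕ) : Type :=
  {w : Fin (n + 1) → ℤ × ℤ // w 0 = a ∧ w (Fin.last n) = b ∧
    (∀ k : Fin n, w k.succ - w k.castSucc ∈ S) ∧ ∀ k, w k ∈ R}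

theorem isEmpty_walks {R : Set (ℤ × ℤ)} {b : ℤ × ℤ} (S : Set (ℤ × ℤ)) (a : ℤ × ℤ)
    (hb : b ∉ R) (n : ℕ) : IsEmpty (Walks S R a b n) :=
  ⟨fun w => hb (w.2.2.1 ▸ w.2.2.2.2 _)⟩

theorem subsingleton_walks_zero (S R : Set (ℤ × ℤ)) (a b : ℤ × ℤ) :
    Subsingleton (Walks S R a b 0) :=
  ⟨fun v w => Subtype.ext (funext fun k => by rw [Fin.fin_one_eq_zero k, v.2.1, w.2.1])⟩

/-- Splitting off the last step of a walk that ends inside the region. -/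
def walkSnocEquiv (S : Finset (ℤ × ℤ)) {R : Set (ℤ × ℤ)} (a : ℤ × ℤ) {b : ℤ × ℤ} (hb : b ∈ R)
    (n : ℕ) : Walks S R a b (n + 1) ≃ Σ s : S, Walks S R a (b - s) n where
  toFun w := ⟨⟨b - w.1 (Fin.last n).castSucc, by
      have h := w.2.2.2.1 (Fin.last n)
      rwa [Fin.succ_last, w.2.2.1] at h⟩, Fin.init w.1, w.2.1, (sub_sub_cancel _ _).symm,
      fun k => w.2.2.2.1 k.castSucc, fun k => w.2.2.2.2 _⟩
  invFun w := ⟨Fin.snoc (α := fun _ => ℤ × ℤ) w.2.1 b,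
      (Fin.snoc_castSucc (α := fun _ => ℤ × ℤ) b w.2.1 0).trans w.2.2.1, Fin.snoc_last _ _,
      fun k => by
        refine Fin.lastCases ?_ (fun k => ?_) k
        · rw [Fin.succ_last, Fin.snoc_last, Fin.snoc_castSucc, w.2.2.2.1, sub_sub_cancel]
          exact w.1.2
        · rw [Fin.succ_castSucc, Fin.snoc_castSucc, Fin.snoc_castSucc]
          exact w.2.2.2.2.1 k,
      fun k => by
        refine Fin.lastCases ?_ (fun k => ?_) k
        · rwa [Fin.snoc_last]
        · rw [Fin.snoc_castSucc]
          exact w.2.2.2.2.2 k⟩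
  left_inv w := by
    obtain ⟨w, h0, rfl, h⟩ := w
    exact Subtype.ext (Fin.snoc_init_self w)
  right_inv := by
    have hext : ∀ x y : Σ s : S, Walks S R a (b - s) n, x.1 = y.1 → x.2.1 = y.2.1 → x = y := by
      rintro ⟨s, v⟩ ⟨_, w⟩ rfl h
      exact congrArg _ (Subtype.ext h)
    refine fun w => hext _ _ (Subtype.ext ?_)
      (Fin.init_snoc (α := fun _ => ℤ × ℤ) b w.2.1)
    change b - Fin.snoc (α := fun _ => ℤ × ℤ) w.2.1 b (Fin.last n).castSucc = w.1
    rw [Fin.snoc_castSucc, w.2.2.2.1, sub_sub_cancel]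

theorem finite_walks (S : Finset (ℤ × ℤ)) (R : Set (ℤ × ℤ)) (a b : ℤ × ℤ) (n : ℕ) :
    Finite (Walks S R a b n) := by
  induction n generalizing b with
  | zero =>
    have := subsingleton_walks_zero S R a b
    infer_instance
  | succ n ih =>
    by_cases hb : b ∈ R
    · have := fun s : S => ih (b - s)
      exact Finite.of_equiv _ (walkSnocEquiv S a hb n).symm
    · have := isEmpty_walks S a hb (n + 1)
      infer_instance

theorem walkCount_eq_zero {R : Set (ℤ × ℤ)} {b : ℤ × ℤ} (S : Set (ℤ × ℤ)) (a : ℤ × ℤ)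
    (hb : b ∉ R) (n : ℕ) : walkCount S R a b n = 0 := by
  have := isEmpty_walks S a hb n
  exact Nat.card_of_isEmpty (α := Walks S R a b n)

theorem walkCount_zero (S : Set (ℤ × ℤ)) {R : Set (ℤ × ℤ)} {a : ℤ × ℤ} (ha : a ∈ R) (b : ℤ × ℤ) :
    walkCount S R a b 0 = if b = a then 1 else 0 := by
  have h := subsingleton_walks_zero S R a b
  split_ifs with hba
  · subst hba
    exact Nat.card_eq_one_iff_unique.2
      ⟨h, ⟨⟨fun _ => b, rfl, rfl, fun k => k.elim0, fun _ => ha⟩⟩⟩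
  · have : IsEmpty (Walks S R a b 0) := ⟨fun w => hba (w.2.2.1.symm.trans w.2.1)⟩
    exact Nat.card_of_isEmpty (α := Walks S R a b 0)

theorem walkCount_succ (S : Finset (ℤ × ℤ)) {R : Set (ℤ × ℤ)} (a : ℤ × ℤ) {b : ℤ × ℤ}
    (hb : b ∈ R) (n : ℕ) :
    walkCount S R a b (n + 1) = ∑ s ∈ S, walkCount S R a (b - s) n := by
  have := fun s : S => finite_walks S R a (b - s) n
  rw [walkCount, Nat.card_congr (walkSnocEquiv S a hb n), Nat.card_sigma]
  exact Finset.sum_coe_sort S fun s => walkCount S R a (b - s) n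

theorem cone_walkCount_succ {i j : ℤ} (h : 0 ≤ i ∨ 0 ≤ j) (n : ℕ) :
    walkCount squareSteps coneC (0, 0) (i, j) (n + 1)
      = walkCount squareSteps coneC (0, 0) (i - 1, j) n
        + walkCount squareSteps coneC (0, 0) (i + 1, j) n
        + walkCount squareSteps coneC (0, 0) (i, j - 1) n
        + walkCount squareSteps coneC (0, 0) (i, j + 1) n := by
  have hS : squareSteps = (({(1, 0), (-1, 0), (0, 1), (0, -1)} : Finset (ℤ × ℤ)) : Set _) := by
    simp [squareSteps]
  rw [hS, walkCount_succ _ _ (show (i, j) ∈ coneC from h)]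
  simp [add_assoc]

/-- The number of walks of length `n` from `0` to `u` on the line, with steps `±1`. -/
def lineCount : ℕ → ℤ → ℚ
  | 0, u => if u = 0 then 1 else 0
  | n + 1, u => lineCount n (u - 1) + lineCount n (u + 1)

theorem lineCount_neg (n : ℕ) (u : ℤ) : lineCount n (-u) = lineCount n u := by
  induction n generalizing u with
  | zero => simp [lineCount]
  | succ n ih =>
    rw [lineCount, lineCount, ← ih (u - 1), ← ih (u + 1), neg_sub, neg_add, add_comm]
    ring_nf

theorem lineCount_eq_zero {n : ℕ} {u : ℤ} (h : u < -n) : lineCount n u = 0 := by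
  induction n generalizing u with
  | zero => exact if_neg (by omega)
  | succ n ih => rw [lineCount, ih (by omega), ih (by omega), add_zero]

theorem lineCount_eq_choose (n k : ℕ) : lineCount n (2 * k - n) = n.choose k := by
  induction n generalizing k with
  | zero => rcases k with _ | k <;> simp [lineCount]; omega
  | succ n ih =>
    rw [lineCount, show (2 * k - (n + 1 : ℕ) + 1 : ℤ) = 2 * k - n by push_cast; ring, ih]
    rcases k with _ | k
    · rw [lineCount_eq_zero (by push_cast; omega)]
      simp
    · rw [show (2 * (k + 1 : ℕ) - (n + 1 : ℕ) - 1 : ℤ) = 2 * k - n by push_cast; ring, ih,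
        Nat.choose_succ_succ, Nat.cast_add]

/-- The signed sum of free square-lattice walks from the four images of the origin under the
reflections in the lines `i = -1` and `j = -1`. -/
def reflectedCount (n : ℕ) (i j : ℤ) : ℚ :=
  lineCount n (i + j) * lineCount n (i - j) - lineCount n (i + j + 2) * lineCount n (i - j + 2)
    - lineCount n (i + j + 2) * lineCount n (i - j - 2)
    + lineCount n (i + j + 4) * lineCount n (i - j)

theorem reflectedCount_succ (n : ℕ) (i j : ℤ) :
    reflectedCount (n + 1) i j = reflectedCount n (i - 1) j + reflectedCount n (i + 1) j
      + reflectedCount n i (j - 1) + reflectedCount n i (j + 1) := by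
  simp only [reflectedCount, lineCount]
  ring_nf

theorem reflectedCount_swap (n : ℕ) (i j : ℤ) : reflectedCount n j i = reflectedCount n i j := by
  simp only [reflectedCount]
  rw [← lineCount_neg n (j - i), ← lineCount_neg n (j - i + 2), ← lineCount_neg n (j - i - 2)]
  ring_nf

theorem reflectedCount_neg_one (n : ℕ) (j : ℤ) : reflectedCount n (-1) j = 0 := by
  simp only [reflectedCount]
  rw [← lineCount_neg n (-1 - j), ← lineCount_neg n (-1 - j - 2), ← lineCount_neg n (-1 - j + 2)]
  ring_nf

theorem reflectedCount_zero {i j : ℤ} (hi : 0 ≤ i) :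
    reflectedCount 0 i j = (if i = 0 ∧ j = 0 then 1 else 0) - if i = 0 ∧ j = -2 then 1 else 0 := by
  simp only [reflectedCount, lineCount]
  split_ifs <;> first | omega | norm_num

theorem poch_half (n : ℕ) : 4 ^ n * poch (1 / 2) n = n.centralBinom * n.factorial := by
  induction n with
  | zero => simp [poch_zero]
  | succ n ih =>
    have h : ((n + 1 : ℕ) * (n + 1).centralBinom : ℚ) = 2 * (2 * n + 1) * n.centralBinom := by
      exact_mod_cast n.succ_mul_centralBinom_succ
    rw [poch_succ, Nat.factorial_succ]
    push_cast at h ⊢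
    linear_combination (4 * (1 / 2 + n)) * ih - n.factorial * h

theorem poch_two (n : ℕ) : poch 2 n = (n + 1).factorial := by
  induction n with
  | zero => simp [poch_zero]
  | succ n ih =>
    rw [poch_succ, ih, Nat.factorial_succ (n + 1)]
    push_cast
    ring

theorem reflectedCount_origin (n : ℕ) :
    reflectedCount (2 * n) 0 0
      = 4 * 16 ^ n * (poch (1 / 2) n * poch (1 / 2) (n + 1)) / (poch 2 n * poch 2 (n + 1)) := by
  have h0 : lineCount (2 * n) 0 = n.centralBinom := by
    rw [Nat.centralBinom, ← lineCount_eq_choose]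
    congr 1; push_cast; ring
  have h1 : lineCount (2 * n) 2 * (n + 1) = n.centralBinom * n := by
    rw [show (2 : ℤ) = 2 * (n + 1 : ℕ) - (2 * n : ℕ) by push_cast; ring, lineCount_eq_choose]
    have h := Nat.choose_succ_right_eq (2 * n) n
    rw [show 2 * n - n = n by omega] at h
    exact_mod_cast h
  have h2 : lineCount (2 * n) 4 * (n + 2) = lineCount (2 * n) 2 * (n - 1) := by
    rcases n with _ | n
    · simp [lineCount]
    · have h4 : lineCount (2 * (n + 1)) 4 = (2 * (n + 1)).choose (n + 1 + 1 + 1) := by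
        rw [← lineCount_eq_choose]
        congr 1; push_cast; ring
      have h2 : lineCount (2 * (n + 1)) 2 = (2 * (n + 1)).choose (n + 1 + 1) := by
        rw [← lineCount_eq_choose]
        congr 1; push_cast; ring
      rw [h2, h4]
      have h := Nat.choose_succ_right_eq (2 * (n + 1)) (n + 1 + 1)
      rw [show 2 * (n + 1) - (n + 1 + 1) = n by omega] at h
      push_cast
      rw [add_sub_cancel_right]
      exact_mod_cast h
  have h3 : lineCount (2 * n) (-2) = lineCount (2 * n) 2 := lineCount_neg _ _
  have hn1 : (n + 1 : ℚ) ≠ 0 := by positivity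
  have hn2 : (n + 2 : ℚ) ≠ 0 := by positivity
  have hf : (n.factorial : ℚ) ≠ 0 := by positivity
  have hp : (16 : ℚ) ^ n * poch (1 / 2) n * poch (1 / 2) n
      = (n.centralBinom * n.factorial) ^ 2 := by
    rw [← poch_half, show (16 : ℚ) = 4 * 4 by norm_num, mul_pow]
    ring
  rw [poch_two, poch_two, poch_succ, Nat.factorial_succ (n + 1), Nat.factorial_succ]
  simp only [reflectedCount, add_zero, sub_zero, zero_add, zero_sub, h3, h0]
  rw [eq_div_of_mul_eq hn2 h2, eq_div_of_mul_eq hn1 h1,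
    show 4 * (16 : ℚ) ^ n * (poch (1 / 2) n * (poch (1 / 2) n * (1 / 2 + n)))
      = (4 * n + 2) * (n.centralBinom * n.factorial) ^ 2 by linear_combination (4 * n + 2) * hp]
  push_cast
  field_simp
  ring

theorem cone_walkCount_swap (n : ℕ) (i j : ℤ) :
    walkCount squareSteps coneC (0, 0) (j, i) n = walkCount squareSteps coneC (0, 0) (i, j) n := by
  induction n generalizing i j with
  | zero =>
    have h : ((0, 0) : ℤ × ℤ) ∈ coneC := Or.inl le_rfl
    rw [walkCount_zero _ h, walkCount_zero _ h]
    simp only [Prod.mk.injEq, and_comm]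
  | succ n ih =>
    by_cases h : 0 ≤ i ∨ 0 ≤ j
    · rw [cone_walkCount_succ h, cone_walkCount_succ h.symm, ih (i - 1), ih (i + 1), ih i (j - 1),
        ih i (j + 1)]
      ring
    · rw [walkCount_eq_zero _ _ (show (i, j) ∉ coneC from h),
        walkCount_eq_zero _ _ (show (j, i) ∉ coneC from fun h' => h h'.symm)]

/-- The walks to `(i, j)` in the cone, minus a third of the reflected count. -/
noncomputable def coneDefect (n : ℕ) (i j : ℤ) : ℚ :=
  walkCount squareSteps coneC (0, 0) (i, j) n - reflectedCount n i j / 3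

theorem coneDefect_succ {i j : ℤ} (h : 0 ≤ i ∨ 0 ≤ j) (n : ℕ) :
    coneDefect (n + 1) i j = coneDefect n (i - 1) j + coneDefect n (i + 1) j
      + coneDefect n i (j - 1) + coneDefect n i (j + 1) := by
  simp only [coneDefect]
  rw [cone_walkCount_succ h, reflectedCount_succ]
  push_cast
  ring

theorem coneDefect_swap (n : ℕ) (i j : ℤ) : coneDefect n j i = coneDefect n i j := by
  rw [coneDefect, cone_walkCount_swap, reflectedCount_swap, coneDefect]

theorem coneDefect_neg_one {j : ℤ} (hj : j < 0) (n : ℕ) : coneDefect n (-1) j = 0 := by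
  have h : ((-1, j) : ℤ × ℤ) ∉ coneC := fun h => by
    rcases h with h | h <;> simp at h
    omega
  rw [coneDefect, walkCount_eq_zero _ _ h, reflectedCount_neg_one]
  simp

theorem coneDefect_zero {i j : ℤ} (hi : 0 ≤ i) :
    coneDefect 0 i j = if i = 0 then if j = 0 then 2 / 3 else if j = -2 then 1 / 3 else 0 else 0 := by
  rw [coneDefect, walkCount_zero _ (show ((0, 0) : ℤ × ℤ) ∈ coneC from Or.inl le_rfl),
    reflectedCount_zero hi]
  simp only [Prod.mk.injEq]
  split_ifs <;> first | omega | norm_num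

theorem coneDefect_origin (n : ℕ) :
    coneDefect (2 * n) 0 0 = 4 * 16 ^ n / 3 ^ 5 *
      (4 * (24 * (n : ℚ) ^ 2 + 60 * n + 29) *
          (poch (1 / 2) n * poch (7 / 6) n) / (poch 2 (n + 1) * poch (4 / 3) (n + 1))
        - 2 * (12 * (n : ℚ) ^ 2 + 30 * n + 5) *
          (poch (1 / 2) n * poch (5 / 6) n) / (poch 2 (n + 1) * poch (5 / 3) (n + 1))) := by
  have h := half_cone_count
    (l := fun n a i => (if a = 0 then 1 / 2 else 1) * coneDefect n i (i - a)) ?_ ?_ n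
  · simp only [if_true, Nat.cast_zero, sub_zero] at h
    linear_combination h / 3
  · intro a i
    rw [coneDefect_zero (by positivity)]
    split_ifs <;> first | omega | norm_num
  · intro n a i
    rw [coneDefect_succ (Or.inl (by positivity))]
    have hprev : ∀ a : ℕ, (if i = 0 then 0 else
        (if a = 0 then 1 / 2 else 1) * coneDefect n (i - 1 : ℕ) ((i - 1 : ℕ) - a))
          = (if a = 0 then 1 / 2 else 1) * coneDefect n (i - 1) (i - (a + 1 : ℕ)) := by
      intro a
      rcases i with _ | i
      · rw [if_pos rfl, Nat.cast_zero, zero_sub, zero_sub, coneDefect_neg_one (by omega), mul_zero]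
      · simp
    rcases a with _ | a
    · simp only [if_true, if_false, Nat.cast_zero, sub_zero, zero_add, Nat.cast_one, one_ne_zero,
        Nat.cast_add, add_zero, add_sub_cancel_right]
      rw [coneDefect_swap n (i - 1), coneDefect_swap n (i + 1)]
      ring
    · simp only [Nat.add_sub_cancel, Nat.succ_ne_zero, if_false, hprev]
      rw [show (i - (a + 1 : ℕ) - 1 : ℤ) = i - (a + 1 + 1 : ℕ) by push_cast; ring,
        show ((i + 1 : ℕ) - (a + 1 + 1 : ℕ) : ℤ) = i - (a + 1 : ℕ) by push_cast; ring,
        show (i - (a + 1 : ℕ) + 1 : ℤ) = i - a by push_cast; ring, Nat.cast_succ i]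
      rcases eq_or_ne a 0 with rfl | ha
      · simp only [zero_add, if_true]
        ring
      · simp only [ha, Nat.add_eq_right, if_false]
        ring

theorem square_threeQuadrant_origin_count (n : ℕ) :
    (walkCount squareSteps coneC (0, 0) (0, 0) (2*n) : ℚ) =
      4 * 16^n / 3^5 *
        (3^4 * (poch (1/2) n * poch (1/2) (n+1)) / (poch 2 n * poch 2 (n+1))
          + 4 * (24 * (n : ℚ)^2 + 60 * n + 29) *
              (poch (1/2) n * poch (7/6) n) / (poch 2 (n+1) * poch (4/3) (n+1))
          - 2 * (12 * (n : ℚ)^2 + 30 * n + 5) *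
              (poch (1/2) n * poch (5/6) n) / (poch 2 (n+1) * poch (5/3) (n+1))) := by
  have h := coneDefect_origin n
  rw [coneDefect, reflectedCount_origin] at h
  linear_combination h
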